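/- arXiv:1311.6656 — 3 statements merged into one kernel-verified Lean document; each statement's English description precedes it below -/
import Mathlib

section
/- Let b ≥ 2 be an integer and T : [0,1) → [0,1) be the b-adic map Tx = bx mod 1. For any t ≥ 0, the Hausdorff dimension of the set {x ∈ [0,1) : |T^n x − x| < b^{-tn} for infinitely many n ∈ ℕ} is equal to 1/(1+t). -/
open Filter

namespace BadicRec

/-! ### iterates -/

lemma fract_mul_fract (b : ℕ) (y : ℝ) : Int.fract ((b : ℝ) * Int.fract y) = Int.fract ((b : ℝ) * y) := by
  rw [Int.fract_eq_fract]
  refine ⟨-(b * ⌊y⌋), ?_⟩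
  have := Int.self_sub_floor y
  rw [← this]; push_cast; ring

lemma iterate_eq (b n : ℕ) {x : ℝ} (hx : x ∈ Set.Ico (0 : ℝ) 1) :
    (fun y : ℝ => Int.fract ((b : ℝ) * y))^[n] x = Int.fract ((b : ℝ) ^ n * x) := by
  induction n with
  | zero => simpa using (Int.fract_eq_self.2 hx).symm
  | succ n ih =>
    rw [Function.iterate_succ_apply', ih]
    rw [fract_mul_fract, pow_succ']
    ring_nf

/-! ### upper bound -/

/-- The set of points `x` with `|(b^n-1) x - k| < b^{-tn}`. -/
def A (b : ℕ) (t : ℝ) (n k : ℕ) : Set ℝ :=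
  {x : ℝ | |((b : ℝ) ^ n - 1) * x - k| < (b : ℝ) ^ (-(t * (n : ℝ)))}

lemma ediam_A_le (b : ℕ) (hb : 2 ≤ b) (t : ℝ) (n k : ℕ) (hn : 1 ≤ n) :
    Metric.ediam (A b t n k) ≤ ENNReal.ofReal (4 * ((b : ℝ) ^ (-(1 + t))) ^ n) := by
  have hb' : (2 : ℝ) ≤ b := by exact_mod_cast hb
  have hb0 : (0 : ℝ) < b := by linarith
  refine Metric.ediam_le ?_
  intro x hx y hy
  rw [edist_dist, Real.dist_eq]
  apply ENNReal.ofReal_le_ofReal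
  simp only [A, Set.mem_ofPred_eq] at hx hy
  have h1 : (b : ℝ) ^ n * ((b : ℝ) ^ (-(1 + t))) ^ n = (b : ℝ) ^ (-(t * (n : ℝ))) := by
    rw [← Real.rpow_natCast, ← Real.rpow_natCast, ← Real.rpow_mul hb0.le, ← Real.rpow_add hb0]
    ring_nf
  have h2 : (2 : ℝ) ≤ (b : ℝ) ^ n := by
    calc (2 : ℝ) ≤ b := hb'
      _ = (b : ℝ) ^ 1 := by simp
      _ ≤ _ := pow_le_pow_right₀ (by linarith) hn
  have h3 : ((b : ℝ) ^ n - 1) * |x - y| ≤ 2 * (b : ℝ) ^ (-(t * (n : ℝ))) := by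
    rw [← abs_of_nonneg (by linarith : (0 : ℝ) ≤ (b : ℝ) ^ n - 1), ← abs_mul]
    rw [abs_lt] at hx hy
    rw [abs_le]
    constructor <;> nlinarith
  have h4 : (b : ℝ) ^ n * |x - y| ≤ (b : ℝ) ^ n * (4 * ((b : ℝ) ^ (-(1 + t))) ^ n) := by
    have : (b : ℝ) ^ n * (4 * ((b : ℝ) ^ (-(1 + t))) ^ n) = 4 * (b : ℝ) ^ (-(t * (n : ℝ))) := by
      rw [← h1]; ring
    rw [this]
    nlinarith [abs_nonneg (x - y)]
  exact le_of_mul_le_mul_left h4 (by positivity)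

lemma upper (b : ℕ) (hb : 2 ≤ b) (t : ℝ) (ht : 0 ≤ t) :
    dimH {x : ℝ | x ∈ Set.Ico (0 : ℝ) 1 ∧
        ∃ᶠ n : ℕ in atTop,
          |(fun y : ℝ => Int.fract ((b : ℝ) * y))^[n] x - x| < (b : ℝ) ^ (-(t * (n : ℝ)))} ≤
      ENNReal.ofReal (1 / (1 + t)) := by
  have hb' : (2 : ℝ) ≤ b := by exact_mod_cast hb
  have hb0 : (0 : ℝ) < b := by linarith
  refine dimH_le fun s hs => ?_
  by_contra hlt
  push Not at hlt
  have hs1 : 1 / (1 + t) < (s : ℝ) := by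
    rw [ENNReal.ofReal_lt_iff_lt_toReal (by positivity) (by simp)] at hlt
    simpa using hlt
  set c : ℝ := (b : ℝ) ^ (-(1 + t)) with hc
  have hc0 : 0 < c := by positivity
  have hc1 : c < 1 := Real.rpow_lt_one_of_one_lt_of_neg (by linarith) (by linarith)
  have hs0 : 0 < (s : ℝ) := lt_trans (by positivity) hs1
  set ρ : ℝ := (b : ℝ) * c ^ (s : ℝ) with hρ
  have hρ0 : 0 < ρ := by positivity
  have hρ1 : ρ < 1 := by
    have : ρ = (b : ℝ) ^ (1 + -(1 + t) * s) := by
      rw [Real.rpow_add hb0, Real.rpow_one, Real.rpow_mul hb0.le]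
    rw [this]
    apply Real.rpow_lt_one_of_one_lt_of_neg (by linarith)
    rw [div_lt_iff₀ (by linarith)] at hs1
    linarith
  -- bound on the sums
  have key : ∀ N : ℕ, ∑' i : (Σ n : ℕ, Fin (b ^ (N + n + 1))),
      Metric.ediam (A b t (N + i.1 + 1) i.2) ^ (s : ℝ) ≤
        ENNReal.ofReal (4 ^ (s : ℝ)) * (1 - ENNReal.ofReal ρ)⁻¹ := by
    intro N
    rw [ENNReal.tsum_sigma', ← ENNReal.tsum_geometric, ← ENNReal.tsum_mul_left]
    refine ENNReal.tsum_le_tsum fun n => ?_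
    calc ∑' k : Fin (b ^ (N + n + 1)), Metric.ediam (A b t (N + n + 1) k) ^ (s : ℝ)
        ≤ ∑' k : Fin (b ^ (N + n + 1)), ENNReal.ofReal (4 * c ^ (N + n + 1)) ^ (s : ℝ) := by
          refine ENNReal.tsum_le_tsum fun k => ?_
          exact ENNReal.rpow_le_rpow (ediam_A_le b hb t _ _ (by omega)) hs0.le
      _ = ENNReal.ofReal ((b : ℝ) ^ (N + n + 1) * (4 * c ^ (N + n + 1)) ^ (s : ℝ)) := by
          rw [tsum_fintype, Finset.sum_const, Finset.card_univ, Fintype.card_fin, nsmul_eq_mul,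
            ENNReal.ofReal_rpow_of_nonneg (by positivity) hs0.le, ENNReal.ofReal_mul (by positivity),
            ← Nat.cast_pow, ENNReal.ofReal_natCast]
      _ = ENNReal.ofReal (4 ^ (s : ℝ) * ρ ^ (N + n + 1)) := by
          congr 1
          rw [Real.mul_rpow (by positivity) (by positivity), hρ, mul_pow, ← Real.rpow_natCast c,
            ← Real.rpow_mul hc0.le, mul_comm _ (s : ℝ), Real.rpow_mul hc0.le, Real.rpow_natCast]
          ring
      _ ≤ ENNReal.ofReal (4 ^ (s : ℝ)) * ENNReal.ofReal ρ ^ n := by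
          rw [← ENNReal.ofReal_pow hρ0.le, ← ENNReal.ofReal_mul (by positivity)]
          apply ENNReal.ofReal_le_ofReal
          gcongr 4 ^ (s : ℝ) * ?_
          exact pow_le_pow_of_le_one hρ0.le hρ1.le (by omega)
  have hfin : ENNReal.ofReal (4 ^ (s : ℝ)) * (1 - ENNReal.ofReal ρ)⁻¹ < ⊤ := by
    apply ENNReal.mul_lt_top ENNReal.ofReal_lt_top
    rw [ENNReal.inv_lt_top, tsub_pos_iff_lt]
    simpa using hρ1
  refine absurd hs (ne_of_lt (lt_of_le_of_lt ?_ hfin))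
  refine (MeasureTheory.Measure.hausdorffMeasure_le_liminf_tsum (β := ℕ)
    (ι := fun N => Σ n : ℕ, Fin (b ^ (N + n + 1))) (s : ℝ) _ (l := atTop)
    (fun N => ENNReal.ofReal (4 * c ^ N)) ?_ (fun N i => A b t (N + i.1 + 1) i.2) ?_ ?_).trans ?_
  · have : Tendsto (fun N : ℕ => 4 * c ^ N) atTop (nhds (4 * 0)) :=
      (tendsto_pow_atTop_nhds_zero_of_lt_one hc0.le hc1).const_mul 4
    simpa using ENNReal.tendsto_ofReal this
  · refine Eventually.of_forall fun N i => (ediam_A_le b hb t _ _ (by omega)).trans ?_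
    apply ENNReal.ofReal_le_ofReal
    gcongr 4 * ?_
    exact pow_le_pow_of_le_one hc0.le hc1.le (by omega)
  · refine Eventually.of_forall fun N x hx => ?_
    obtain ⟨hx01, hx⟩ := hx
    obtain ⟨n, hn, hxn⟩ := (frequently_atTop.1 hx) (N + 1)
    rw [iterate_eq b n hx01] at hxn
    obtain ⟨m, rfl⟩ : ∃ m, n = N + m + 1 := ⟨n - (N + 1), by omega⟩
    have hpos : 0 ≤ (b : ℝ) ^ (N + m + 1) * x := mul_nonneg (by positivity) hx01.1
    have hk : ⌊(b : ℝ) ^ (N + m + 1) * x⌋₊ < b ^ (N + m + 1) := by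
      rw [Nat.floor_lt hpos]
      push_cast
      have : 0 < (b : ℝ) ^ (N + m + 1) := by positivity
      nlinarith [hx01.2]
    refine Set.mem_iUnion.2 ⟨⟨m, ⟨_, hk⟩⟩, ?_⟩
    simp only [A, Set.mem_ofPred_eq]
    convert hxn using 2
    rw [← Int.self_sub_floor, natCast_floor_eq_intCast_floor hpos]
    ring
  · refine liminf_le_of_frequently_le' (Frequently.of_forall fun N => key N)


/-! ### digit prefixes -/

/-- The integer formed by the first `m` digits. -/
def pre {b : ℕ} (d : ℕ → Fin b) : ℕ → ℕ
  | 0 => 0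
  | m + 1 => b * pre d m + d m

lemma pre_spec {b : ℕ} (hb : 2 ≤ b) (d : ℕ → Fin b) (m : ℕ) :
    (b : ℝ) ^ m * Real.ofDigits d = pre d m + Real.ofDigits (fun i => d (i + m)) := by
  have hb0 : (b : ℝ) ≠ 0 := by positivity
  induction m with
  | zero => simp [pre]
  | succ m ih =>
    have h := Real.ofDigits_eq_sum_add_ofDigits (fun i => d (i + m)) 1
    simp only [Finset.range_one, Finset.sum_singleton, Real.ofDigitsTerm] at h
    rw [pow_succ', mul_assoc, ih, h, pre]
    have e : (fun i => d (i + 1 + m)) = fun i => d (i + (m + 1)) := by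
      ext i; congr 2; omega
    rw [e]
    simp only [zero_add, pow_one]
    push_cast
    field_simp
    ring

lemma pre_lex {b : ℕ} (d d' : ℕ → Fin b) (k : ℕ) (h : ∀ i < k, d i = d' i) (hk : d k < d' k)
    (m : ℕ) (hm : k < m) : pre d m + 1 ≤ pre d' m := by
  have h0 : ∀ j ≤ k, pre d j = pre d' j := by
    intro j hj
    induction j with
    | zero => rfl
    | succ j ih => simp only [pre]; rw [ih (by omega), h j (by omega)]
  induction m, hm using Nat.le_induction with
  | base =>
    simp only [pre]; rw [h0 k le_rfl]
    have : (d k : ℕ) < d' k := hk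
    omega
  | succ m hm ih =>
    simp only [pre]
    have h1 : (d m : ℕ) < b := (d m).2
    have h2 : b * (pre d m + 1) ≤ b * pre d' m := Nat.mul_le_mul_left b ih
    rw [Nat.mul_add] at h2
    omega

lemma ofDigits_le_of_lex {b : ℕ} (hb : 2 ≤ b) (d d' : ℕ → Fin b) (k : ℕ)
    (h : ∀ i < k, d i = d' i) (hk : d k < d' k) : Real.ofDigits d ≤ Real.ofDigits d' := by
  have h1 := pre_spec hb d (k + 1)
  have h2 := pre_spec hb d' (k + 1)
  have h3 : (pre d (k + 1) : ℝ) + 1 ≤ pre d' (k + 1) := by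
    exact_mod_cast pre_lex d d' k h hk (k + 1) (by omega)
  have h4 := Real.ofDigits_le_one (fun i => d (i + (k + 1)))
  have h5 := Real.ofDigits_nonneg (fun i => d' (i + (k + 1)))
  have : (0 : ℝ) < (b : ℝ) ^ (k + 1) := by positivity
  refine le_of_mul_le_mul_left ?_ this
  linarith

lemma pre_lt {b : ℕ} (d : ℕ → Fin b) (m : ℕ) : pre d m + 1 ≤ b ^ m := by
  induction m with
  | zero => simp [pre]
  | succ m ih =>
    simp only [pre]
    have h1 : (d m : ℕ) < b := (d m).2
    have h2 : b * (pre d m + 1) ≤ b * b ^ m := Nat.mul_le_mul_left b ih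
    rw [Nat.mul_add] at h2
    rw [pow_succ']
    omega

lemma ofDigits_lt_one {b : ℕ} (hb : 2 ≤ b) (d : ℕ → Fin b) (k : ℕ) (hk : (d k : ℕ) = 0) :
    Real.ofDigits d < 1 := by
  have h1 := pre_spec hb d (k + 1)
  have h2 : pre d (k + 1) + 2 ≤ b ^ (k + 1) := by
    simp only [pre]
    have h2 : b * (pre d k + 1) ≤ b * b ^ k := Nat.mul_le_mul_left b (pre_lt d k)
    rw [Nat.mul_add] at h2
    rw [pow_succ']
    omega
  have h2' : (pre d (k + 1) : ℝ) + 2 ≤ (b : ℝ) ^ (k + 1) := by exact_mod_cast h2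
  have h4 := Real.ofDigits_le_one (fun i => d (i + (k + 1)))
  have : (0 : ℝ) < (b : ℝ) ^ (k + 1) := by positivity
  refine lt_of_mul_lt_mul_left ?_ this.le
  linarith

lemma fract_pow_mul {b : ℕ} (hb : 2 ≤ b) (d : ℕ → Fin b) (hz : ∀ n, ∃ k, (d (k + n) : ℕ) = 0)
    (n : ℕ) : Int.fract ((b : ℝ) ^ n * Real.ofDigits d) = Real.ofDigits (fun i => d (i + n)) := by
  rw [pre_spec hb, Int.fract_natCast_add, Int.fract_eq_self]
  obtain ⟨k, hk⟩ := hz n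
  exact ⟨Real.ofDigits_nonneg _, ofDigits_lt_one hb _ k hk⟩

/-! ### expansion of digit sequences -/

section expand

variable {b : ℕ} (free : ℕ → Prop) [DecidablePred free] (X : (ℕ → Fin b) → ℕ → Fin b)

lemma agree
    (hX1 : ∀ a p, free p → X a p = a (Nat.count free p))
    (hX2 : ∀ a a' p, ¬ free p → (∀ i < p, X a i = X a' i) → X a p = X a' p)
    (a a' : ℕ → Fin b) (p : ℕ) (h : ∀ i < Nat.count free p, a i = a' i) :
    ∀ i < p, X a i = X a' i := by
  induction p with
  | zero => simp
  | succ p ih =>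
    have ih' := ih fun i hi => h i (lt_of_lt_of_le hi (Nat.count_monotone free (by omega)))
    intro i hi
    rcases Nat.lt_succ_iff_lt_or_eq.1 hi with hi | rfl
    · exact ih' i hi
    · by_cases hf : free i
      · rw [hX1 a i hf, hX1 a' i hf]
        exact h _ (Nat.count_strict_mono hf (by omega))
      · exact hX2 a a' i hf ih'

lemma step
    (hX1 : ∀ a p, free p → X a p = a (Nat.count free p))
    (hX2 : ∀ a a' p, ¬ free p → (∀ i < p, X a i = X a' i) → X a p = X a' p)
    (hb : 2 ≤ b) [NeZero b] (hinf : (Set.ofPred free).Infinite) (m : ℕ) {u w : ℝ}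
    (hu : u ∈ Set.Ico (0 : ℝ) 1) (hw : w ∈ Set.Ico (0 : ℝ) 1)
    (h : ((b : ℝ) ^ Nat.count free m)⁻¹ < w - u) :
    pre (X (Real.digits u b)) m + 1 ≤ pre (X (Real.digits w b)) m := by
  set a := Real.digits u b
  set a' := Real.digits w b
  have ha : Real.ofDigits a = u := Real.ofDigits_digits (by omega) hu
  have ha' : Real.ofDigits a' = w := Real.ofDigits_digits (by omega) hw
  have hne : ∃ i, i < Nat.count free m ∧ a i ≠ a' i := by
    by_contra hcon
    push Not at hcon
    have := Real.abs_ofDigits_sub_ofDigits_le hcon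
    rw [ha, ha', abs_sub_comm] at this
    linarith [le_abs_self (w - u)]
  classical
  let k := Nat.find hne
  have hk := Nat.find_spec hne
  have hk' : ∀ i < k, a i = a' i := by
    intro i hi
    by_contra hc
    exact Nat.find_min hne hi ⟨lt_trans hi hk.1, hc⟩
  have hlt : a k < a' k := by
    rcases lt_or_gt_of_ne hk.2 with h1 | h1
    · exact h1
    · exfalso
      have := ofDigits_le_of_lex hb a' a k (fun i hi => (hk' i hi).symm) h1
      rw [ha, ha'] at this
      have : 0 < ((b : ℝ) ^ Nat.count free m)⁻¹ := by positivity
      linarith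
  have hc : Nat.count free (Nat.nth free k) = k := Nat.count_nth_of_infinite hinf k
  have hfk : free (Nat.nth free k) := Nat.nth_mem_of_infinite hinf k
  refine pre_lex _ _ (Nat.nth free k) ?_ ?_ m (Nat.nth_lt_of_lt_count hk.1)
  · exact agree free X hX1 hX2 a a' _ (by rwa [hc])
  · rw [hX1 _ _ hfk, hX1 _ _ hfk, hc]; exact hlt

lemma sep
    (hX1 : ∀ a p, free p → X a p = a (Nat.count free p))
    (hX2 : ∀ a a' p, ¬ free p → (∀ i < p, X a i = X a' i) → X a p = X a' p)
    (hb : 2 ≤ b) [NeZero b] (hinf : (Set.ofPred free).Infinite) (m : ℕ) {u v : ℝ}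
    (hu : u ∈ Set.Ico (0 : ℝ) 1) (hv : v ∈ Set.Ico (0 : ℝ) 1)
    (h : |Real.ofDigits (X (Real.digits v b)) - Real.ofDigits (X (Real.digits u b))|
      < ((b : ℝ) ^ m)⁻¹) : v - u ≤ 2 * ((b : ℝ) ^ Nat.count free m)⁻¹ := by
  by_contra hcon
  push Not at hcon
  have hpos : 0 < ((b : ℝ) ^ Nat.count free m)⁻¹ := by positivity
  have hw : (u + v) / 2 ∈ Set.Ico (0 : ℝ) 1 := ⟨by linarith [hu.1, hv.1], by linarith [hu.2, hv.2]⟩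
  have h1 := step free X hX1 hX2 hb hinf m hu hw (by linarith)
  have h2 := step free X hX1 hX2 hb hinf m hw hv (by linarith)
  have h3 : (pre (X (Real.digits u b)) m : ℝ) + 2 ≤ pre (X (Real.digits v b)) m := by
    have : pre (X (Real.digits u b)) m + 2 ≤ pre (X (Real.digits v b)) m := by omega
    exact_mod_cast this
  have h4 := pre_spec hb (X (Real.digits u b)) m
  have h5 := pre_spec hb (X (Real.digits v b)) m
  have h6 := Real.ofDigits_le_one (fun i => X (Real.digits u b) (i + m))
  have h7 := Real.ofDigits_nonneg (fun i => X (Real.digits v b) (i + m))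
  have h8 := lt_of_le_of_lt (le_abs_self _) h
  have hbm : (0 : ℝ) < (b : ℝ) ^ m := by positivity
  rw [← mul_lt_mul_iff_right₀ hbm, mul_inv_cancel₀ hbm.ne'] at h8
  linarith

end expand

/-- Passing from dyadic-type scales to a power bound. -/
lemma holder_of_scales {β D h K r : ℝ} (hβ : 1 < β) (hr : 0 < r) (hK : 0 ≤ K) (hD : 0 ≤ D) (hD1 : D < 1)
    (H : ∀ m : ℕ, D < (β ^ m)⁻¹ → h ≤ K * ((β ^ m)⁻¹) ^ r) : h ≤ K * β ^ r * D ^ r := by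
  have hβ0 : 0 < β := by linarith
  rcases hD.eq_or_lt with rfl | hD0
  · rw [Real.zero_rpow hr.ne', mul_zero]
    have ht : Tendsto (fun m : ℕ => K * ((β ^ m)⁻¹) ^ r) atTop (nhds (K * 0)) := by
      apply Tendsto.const_mul
      have : (fun m : ℕ => ((β ^ m)⁻¹) ^ r) = fun m : ℕ => ((β⁻¹) ^ r) ^ m := by
        ext m
        rw [← inv_pow, ← Real.rpow_natCast, ← Real.rpow_mul (by positivity), mul_comm,
          Real.rpow_mul (by positivity), Real.rpow_natCast]
      rw [this]
      apply tendsto_pow_atTop_nhds_zero_of_lt_one (by positivity)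
      exact Real.rpow_lt_one (by positivity) (inv_lt_one_of_one_lt₀ hβ) hr
    rw [mul_zero] at ht
    exact ge_of_tendsto' ht fun m => H m (by positivity)
  · have hex : ∃ m : ℕ, (β ^ m)⁻¹ ≤ D := by
      obtain ⟨m, hm⟩ := exists_pow_lt_of_lt_one hD0 (inv_lt_one_of_one_lt₀ hβ)
      exact ⟨m, by rw [← inv_pow]; exact hm.le⟩
    classical
    obtain ⟨k, hk⟩ : ∃ k, Nat.find hex = k + 1 := by
      refine Nat.exists_eq_succ_of_ne_zero fun h0 => ?_
      have := Nat.find_spec hex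
      rw [h0] at this
      simp at this
      linarith
    have h1 := Nat.find_spec hex
    rw [hk] at h1
    have h2 : D < (β ^ k)⁻¹ := not_le.1 (Nat.find_min hex (by omega))
    refine (H k h2).trans ?_
    rw [mul_assoc, ← Real.mul_rpow hβ0.le hD]
    have h3 : (β ^ k)⁻¹ ≤ β * D := by
      calc (β ^ k)⁻¹ = β * (β ^ (k + 1))⁻¹ := by rw [pow_succ']; field_simp
        _ ≤ β * D := by gcongr
    gcongr

/-! ### the concrete construction -/

section concrete

/-- Number of copied digits. -/
noncomputable def L (t : ℝ) (n : ℕ) : ℕ := ⌈t * n⌉₊ + 1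

/-- The start of the block containing `p`. -/
def st (q p : ℕ) : ℕ := q ^ Nat.log q p

/-- The free positions. -/
def Fr (t : ℝ) (q p : ℕ) : Prop := p = 0 ∨ st q p + L t (st q p) < p

open Classical in
/-- Expanded digit sequence. -/
noncomputable def X (t : ℝ) (q : ℕ) (hq : 2 ≤ q) {b : ℕ} [NeZero b] (a : ℕ → Fin b) (p : ℕ) : Fin b :=
  if h : Fr t q p then a (Nat.count (Fr t q) p)
  else if p = st q p + L t (st q p) then 0
  else X t q hq a (p - st q p)
termination_by p
decreasing_by
  have h1 : p ≠ 0 := fun h0 => h (Or.inl h0)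
  have h2 : 0 < st q p := by unfold st; positivity
  omega

variable (t : ℝ) (q : ℕ) {b : ℕ} [NeZero b]

open Classical in
lemma X_free (hq : 2 ≤ q) (a : ℕ → Fin b) (p : ℕ) (h : Fr t q p) :
    X t q hq a p = a (Nat.count (Fr t q) p) := by
  rw [X]; simp [h]

lemma X_det (hq : 2 ≤ q) (a a' : ℕ → Fin b) (p : ℕ) (h : ¬ Fr t q p)
    (hi : ∀ i < p, X t q hq a i = X t q hq a' i) : X t q hq a p = X t q hq a' p := by
  conv_lhs => rw [X]
  conv_rhs => rw [X]
  simp only [h, dite_false]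
  split_ifs with h1
  · rfl
  · apply hi
    have h1 : p ≠ 0 := fun h0 => h (Or.inl h0)
    have h2 : 0 < st q p := by unfold st; positivity
    omega

lemma st_eq (j p : ℕ) (h1 : q ^ j ≤ p) (h2 : p < q ^ (j + 1)) : st q p = q ^ j := by
  unfold st
  rw [Nat.log_eq_of_pow_le_of_lt_pow h1 h2]

lemma L_le (ht : 0 ≤ t) (n : ℕ) : (L t n : ℝ) ≤ t * n + 2 := by
  unfold L
  have := (Nat.ceil_lt_add_one (by positivity : 0 ≤ t * n)).le
  push_cast
  linarith

lemma block_lt (ht : 0 ≤ t) (hqt : t + 4 ≤ q) (j : ℕ) : q ^ j + L t (q ^ j) < q ^ (j + 1) := by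
  have h1 := L_le t ht (q ^ j)
  have h0 : 1 ≤ q ^ j := Nat.one_le_pow _ _ (by
    have : (0 : ℝ) < q := by linarith
    exact_mod_cast this)
  have h2 : (1 : ℝ) ≤ (q ^ j : ℕ) := by exact_mod_cast h0
  have h3 : ((q ^ j + L t (q ^ j) : ℕ) : ℝ) < ((q ^ (j + 1) : ℕ) : ℝ) := by
    rw [pow_succ]
    push_cast at *
    nlinarith
  exact_mod_cast h3

lemma X_zero (hq : 2 ≤ q) (ht : 0 ≤ t) (hqt : t + 4 ≤ q) (a : ℕ → Fin b) (j : ℕ) :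
    X t q hq a (q ^ j + L t (q ^ j)) = 0 := by
  have hst := st_eq q j (q ^ j + L t (q ^ j)) (by omega) (block_lt t q ht hqt j)
  have : 0 < q ^ j := by positivity
  rw [X, dif_neg, if_pos]
  · rw [hst]
  · unfold Fr; rw [hst]; omega

lemma X_copy (hq : 2 ≤ q) (ht : 0 ≤ t) (hqt : t + 4 ≤ q) (a : ℕ → Fin b) (j i : ℕ) (hi : i < L t (q ^ j)) :
    X t q hq a (i + q ^ j) = X t q hq a i := by
  have hst := st_eq q j (i + q ^ j) (by omega) (by have := block_lt t q ht hqt j; omega)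
  have : 0 < q ^ j := by positivity
  rw [X, dif_neg, if_neg]
  · rw [hst]; congr 1; omega
  · rw [hst]; omega
  · unfold Fr; rw [hst]; omega

open Classical in
lemma count_block (hq : 2 ≤ q) (j m : ℕ) (h1 : q ^ j ≤ m) (h2 : m ≤ q ^ (j + 1)) :
    Nat.count (Fr t q) (q ^ j) + m ≤ Nat.count (Fr t q) m + q ^ j + L t (q ^ j) + 1 := by
  induction m, h1 using Nat.le_induction with
  | base => omega
  | succ m hm ih =>
    have ih := ih (by omega)
    have hmono : Nat.count (Fr t q) (q ^ j) ≤ Nat.count (Fr t q) (m + 1) :=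
      Nat.count_monotone _ (by omega)
    by_cases hle : m ≤ q ^ j + L t (q ^ j)
    · omega
    · have hf : Fr t q m := by
        right
        rw [st_eq q j m hm (by omega)]
        omega
      rw [Nat.count_succ, if_pos hf]
      omega

open Classical in
lemma count_sub (m n : ℕ) (h : n ≤ m) : Nat.count (Fr t q) m ≤ Nat.count (Fr t q) n + (m - n) := by
  obtain ⟨k, rfl⟩ := Nat.exists_eq_add_of_le h
  rw [Nat.count_add]
  have := Nat.count_le (p := fun k => Fr t q (n + k)) (n := k)
  omega

open Classical in
lemma count_pow (hq : 2 ≤ q) (ht : 0 ≤ t) {ε : ℝ} (hε : 0 < ε) (hqε : ε + t + 3 ≤ ε * q) (j : ℕ) :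
    (q ^ j : ℝ) - ε * q ^ j ≤ Nat.count (Fr t q) (q ^ j) := by
  induction j with
  | zero =>
    have : Fr t q 0 := Or.inl rfl
    have h1 : Nat.count (Fr t q) 1 = 1 := by rw [Nat.count_one, if_pos this]
    simp [h1]
    exact hε.le
  | succ j ih =>
    have h := count_block t q hq j (q ^ (j + 1)) (Nat.pow_le_pow_right (by omega) (by omega)) le_rfl
    have h' : (Nat.count (Fr t q) (q ^ j) : ℝ) + (q : ℝ) ^ (j + 1) ≤
      Nat.count (Fr t q) (q ^ (j + 1)) + (q : ℝ) ^ j + L t (q ^ j) + 1 := by exact_mod_cast h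
    have h1 := L_le t ht (q ^ j)
    push_cast at h1
    have h2 : (1 : ℝ) ≤ (q : ℝ) ^ j := one_le_pow₀ (by exact_mod_cast (by omega : 1 ≤ q))
    have h3 : ε * (q : ℝ) ^ (j + 1) = (ε * q) * q ^ j := by ring
    rw [h3]
    nlinarith

open Classical in
lemma count_ge (hq : 2 ≤ q) (ht : 0 ≤ t) {ε : ℝ} (hε : 0 < ε) (hqε : ε + t + 3 ≤ ε * q) (m : ℕ) :
    (1 / (1 + t) - ε) * m - 3 ≤ Nat.count (Fr t q) m := by
  rcases Nat.eq_zero_or_pos m with rfl | hm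
  · simp
  set j := Nat.log q m
  have h1 : q ^ j ≤ m := Nat.pow_log_le_self q hm.ne'
  have h2 : m < q ^ (j + 1) := Nat.lt_pow_succ_log_self (by omega) m
  have hc := count_pow t q hq ht hε hqε j
  have hb := count_block t q hq j m h1 h2.le
  have hmono : Nat.count (Fr t q) (q ^ j) ≤ Nat.count (Fr t q) m := Nat.count_monotone _ h1
  have hb' : (Nat.count (Fr t q) (q ^ j) : ℝ) + m ≤
      Nat.count (Fr t q) m + (q : ℝ) ^ j + L t (q ^ j) + 1 := by exact_mod_cast hb
  have hm' : (Nat.count (Fr t q) (q ^ j) : ℝ) ≤ Nat.count (Fr t q) m := by exact_mod_cast hmono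
  have hL := L_le t ht (q ^ j)
  push_cast at hL
  have h1' : (q : ℝ) ^ j ≤ m := by exact_mod_cast h1
  set n : ℝ := (q : ℝ) ^ j
  set F : ℝ := ((Nat.count (Fr t q) m : ℕ) : ℝ)
  have e1 : n - ε * n ≤ F := by linarith
  have e2 : m - ε * n - t * n - 3 ≤ F := by linarith
  have ht1 : 0 < 1 + t := by linarith
  have e3 : (1 + t) * ((1 / (1 + t) - ε) * m - 3) ≤ (1 + t) * F := by
    have : (1 + t) * ((1 / (1 + t) - ε) * m - 3) = m - (1 + t) * (ε * m) - 3 * (1 + t) := by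
      field_simp
    rw [this]
    have e4 : t * (n - ε * n) ≤ t * F := mul_le_mul_of_nonneg_left e1 ht
    have e5 : (1 + t) * (ε * n) ≤ (1 + t) * (ε * m) := by gcongr
    nlinarith
  exact le_of_mul_le_mul_left e3 ht1

end concrete

lemma lower (b : ℕ) (hb : 2 ≤ b) (t : ℝ) (ht : 0 ≤ t) :
    ENNReal.ofReal (1 / (1 + t)) ≤
    dimH {x : ℝ | x ∈ Set.Ico (0 : ℝ) 1 ∧
        ∃ᶠ n : ℕ in atTop,
          |(fun y : ℝ => Int.fract ((b : ℝ) * y))^[n] x - x| < (b : ℝ) ^ (-(t * (n : ℝ)))} := by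
  classical
  have hb' : (2 : ℝ) ≤ b := by exact_mod_cast hb
  have hb0 : (0 : ℝ) < b := by linarith
  have : NeZero b := ⟨by omega⟩
  refine le_of_forall_lt fun z hz => ?_
  obtain ⟨r', hzr, hr'⟩ := ENNReal.lt_iff_exists_nnreal_btwn.1 hz
  refine lt_of_lt_of_le hzr ?_
  have hr1 : (r' : ℝ) < 1 / (1 + t) := by
    have := (ENNReal.lt_ofReal_iff_toReal_lt (by simp)).1 hr'
    simpa using this
  have hr0' : 0 < r' := by
    by_contra h0
    have : r' = 0 := by simpa using h0
    simp [this] at hzr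
  have hr0 : 0 < (r' : ℝ) := by exact_mod_cast hr0'
  set ε : ℝ := 1 / (1 + t) - r' with hεdef
  have hε : 0 < ε := by linarith
  obtain ⟨q, hqbig⟩ := exists_nat_ge (max ((ε + t + 3) / ε) (t + 4))
  have hqt : t + 4 ≤ q := (le_max_right _ _).trans hqbig
  have hqε : ε + t + 3 ≤ ε * q := by
    have := (le_max_left _ _).trans hqbig
    rwa [div_le_iff₀' hε] at this
  have hq : 2 ≤ q := by
    have : (2 : ℝ) ≤ q := by linarith
    exact_mod_cast this
  have hcount : ∀ m : ℕ, (r' : ℝ) * m - 3 ≤ Nat.count (Fr t q) m := by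
    intro m
    have := count_ge t q hq ht hε hqε m
    rwa [hεdef, sub_sub_cancel] at this
  have hinf : (Set.ofPred (Fr t q)).Infinite := by
    intro hfin
    obtain ⟨m, hm⟩ := exists_nat_gt ((hfin.toFinset.card + 3 : ℝ) / r')
    rw [div_lt_iff₀' hr0] at hm
    have h1 := hcount m
    have h2 : (Nat.count (Fr t q) m : ℝ) ≤ hfin.toFinset.card := by
      exact_mod_cast Nat.count_le_card hfin m
    linarith
  let g : ℝ → ℝ := fun u => Real.ofDigits (X t q hq (Real.digits u b))
  have hz : ∀ (a : ℕ → Fin b) (n : ℕ), ∃ k, (X t q hq a (k + n) : ℕ) = 0 := by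
    intro a n
    have hn : n < q ^ n := Nat.lt_pow_self (by omega)
    refine ⟨q ^ n + L t (q ^ n) - n, ?_⟩
    rw [show q ^ n + L t (q ^ n) - n + n = q ^ n + L t (q ^ n) by omega, X_zero t q hq ht hqt]
    simp
  have hg1 : ∀ u, g u < 1 := by
    intro u
    obtain ⟨k, hk⟩ := hz (Real.digits u b) 0
    exact ofDigits_lt_one hb _ _ hk
  have hg0 : ∀ u, 0 ≤ g u := fun u => Real.ofDigits_nonneg _
  -- Hölder bound
  have hH : ∀ u ∈ Set.Ico (0 : ℝ) 1, ∀ v ∈ Set.Ico (0 : ℝ) 1,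
      |u - v| ≤ 2 * (b : ℝ) ^ (3 : ℝ) * (b : ℝ) ^ (r' : ℝ) * |g u - g v| ^ (r' : ℝ) := by
    intro u hu v hv
    refine holder_of_scales (by linarith) hr0 (by positivity) (abs_nonneg _) ?_ ?_
    · rw [abs_lt]
      constructor <;> linarith [hg0 u, hg0 v, hg1 u, hg1 v]
    · intro m hm
      have e1 : |u - v| ≤ 2 * ((b : ℝ) ^ Nat.count (Fr t q) m)⁻¹ := by
        rw [abs_sub_le_iff]
        refine ⟨sep (Fr t q) (X t q hq) (X_free t q hq) (X_det t q hq) hb hinf m hv hu hm,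
          sep (Fr t q) (X t q hq) (X_free t q hq) (X_det t q hq) hb hinf m hu hv ?_⟩
        rw [abs_sub_comm]; exact hm
      refine e1.trans ?_
      rw [mul_assoc]
      gcongr 2 * ?_
      rw [← Real.rpow_natCast, ← Real.rpow_natCast, ← Real.rpow_neg hb0.le, ← Real.rpow_neg hb0.le,
        ← Real.rpow_mul hb0.le, ← Real.rpow_add hb0]
      apply Real.rpow_le_rpow_of_exponent_le (by linarith)
      have := hcount m
      linarith
  have hinj : Set.InjOn g (Set.Ico (0 : ℝ) 1) := by
    intro u hu v hv huv
    have := hH u hu v hv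
    rw [huv, sub_self, abs_zero, Real.zero_rpow hr0.ne', mul_zero] at this
    exact sub_eq_zero.1 (abs_nonpos_iff.1 this)
  set E := g '' Set.Ico (0 : ℝ) 1
  let f := Function.invFunOn g (Set.Ico (0 : ℝ) 1)
  have hfg : ∀ u ∈ Set.Ico (0 : ℝ) 1, f (g u) = u := fun u hu => hinj.leftInvOn_invFunOn hu
  have hhol : HolderOnWith (2 * (b : ℝ) ^ (3 : ℝ) * (b : ℝ) ^ (r' : ℝ)).toNNReal r' f E := by
    rintro _ ⟨u, hu, rfl⟩ _ ⟨v, hv, rfl⟩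
    rw [hfg u hu, hfg v hv, edist_dist, edist_dist, Real.dist_eq, Real.dist_eq]
    rw [ENNReal.ofReal_rpow_of_nonneg (abs_nonneg _) hr0.le]
    change _ ≤ ENNReal.ofReal _ * _
    rw [← ENNReal.ofReal_mul (by positivity)]
    exact ENNReal.ofReal_le_ofReal (hH u hu v hv)
  have himg : f '' E = Set.Ico (0 : ℝ) 1 := by
    ext u
    constructor
    · rintro ⟨_, ⟨v, hv, rfl⟩, rfl⟩
      rw [hfg v hv]; exact hv
    · intro hu
      exact ⟨g u, ⟨u, hu, rfl⟩, hfg u hu⟩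
  have hdim1 : dimH (Set.Ico (0 : ℝ) 1) = 1 := by
    rw [Real.dimH_of_nonempty_interior]
    · simp
    · rw [interior_Ico]; simp
  have hdim := hhol.dimH_image_le hr0'
  rw [himg, hdim1] at hdim
  have hE : (r' : ENNReal) ≤ dimH E := by
    rw [ENNReal.le_div_iff_mul_le (by simp [hr0'.ne']) (by simp)] at hdim
    simpa using hdim
  refine hE.trans (dimH_mono ?_)
  rintro _ ⟨u, hu, rfl⟩
  have hmem : g u ∈ Set.Ico (0 : ℝ) 1 := ⟨hg0 u, hg1 u⟩
  refine ⟨hmem, frequently_atTop.2 fun N => ⟨q ^ N, (Nat.lt_pow_self (by omega)).le, ?_⟩⟩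
  rw [iterate_eq b _ hmem, fract_pow_mul hb _ (hz _)]
  have h1 := Real.abs_ofDigits_sub_ofDigits_le (b := b)
    (fun i hi => X_copy t q hq ht hqt (Real.digits u b) N i hi)
  refine lt_of_le_of_lt h1 ?_
  rw [← Real.rpow_natCast, ← Real.rpow_neg hb0.le]
  apply Real.rpow_lt_rpow_of_exponent_lt (by linarith)
  have := Nat.le_ceil (t * (q ^ N : ℕ))
  unfold L
  push_cast at *
  linarith

end BadicRec

/-- For the `b`-adic map `T x = b x mod 1` on `[0,1)` and `t ≥ 0`, the
Hausdorff dimension of the set of points whose orbit returns `b^{-tn}`-close to the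
starting point infinitely often equals `1/(1+t)`. -/
theorem badic_recurrence_dimH (b : ℕ) (hb : 2 ≤ b) (t : ℝ) (ht : 0 ≤ t) :
    dimH {x : ℝ | x ∈ Set.Ico (0 : ℝ) 1 ∧
        ∃ᶠ n : ℕ in atTop,
          |(fun y : ℝ => Int.fract ((b : ℝ) * y))^[n] x - x| < (b : ℝ) ^ (-(t * (n : ℝ)))} =
      ENNReal.ofReal (1 / (1 + t)) := by
  exact le_antisymm (BadicRec.upper b hb t ht) (BadicRec.lower b hb t ht)
end

section
/- Let T : [0,1) → [0,1) be the doubling map Tx = 2x mod 1, and for x with dyadic expansion x = 0.x_1x_2... (x_i ∈ {0,1}), let ξ_n(x) = #{1 ≤ i ≤ n : x_i = 0}. For any t ≥ 0, the Hausdorff dimension of {x ∈ [0,1) : |T^n x − x| < 2^{-t ξ_n(x)} for infinitely many n} equals the unique solution s of the equation 1 + 2^{ts} = 2^{s(t+1)}. -/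
open Filter

/-- The number of zeros among the first `n` binary digits of `x`:
the `(i+1)`-th digit of `x` is `0` iff `Int.fract (2^i * x) < 1/2`. -/
noncomputable def zeroDigitCount (n : ℕ) (x : ℝ) : ℕ :=
  ((Finset.range n).filter fun i => Int.fract ((2 : ℝ) ^ i * x) < 1 / 2).card

/-- The recurrence set of the theorem. -/
def recSet (t : ℝ) : Set ℝ := {x : ℝ | x ∈ Set.Ico (0 : ℝ) 1 ∧
        ∃ᶠ n : ℕ in atTop,
          |(fun y : ℝ => Int.fract (2 * y))^[n] x - x| <
            (2 : ℝ) ^ (-(t * (zeroDigitCount n x : ℝ)))}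

/-- Number of zeros among the `n` lowest binary digits of `j`. -/
def zc : ℕ → ℕ → ℕ
  | 0, _ => 0
  | n + 1, j => zc n (j / 2) + (if j % 2 = 0 then 1 else 0)

theorem iter_eq (x : ℝ) (hx : x ∈ Set.Ico (0 : ℝ) 1) (n : ℕ) :
    (fun y : ℝ => Int.fract (2 * y))^[n] x = Int.fract ((2 : ℝ) ^ n * x) := by
  induction n with
  | zero => simp [Int.fract_eq_self.2 ⟨hx.1, hx.2⟩]
  | succ n ih =>
    rw [Function.iterate_succ_apply', ih, Int.fract_eq_fract]
    refine ⟨-2 * ⌊(2 : ℝ) ^ n * x⌋, ?_⟩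
    have := Int.self_sub_floor ((2 : ℝ) ^ n * x)
    push_cast
    rw [← this]; ring

theorem zeroDigitCount_succ (n : ℕ) (x : ℝ) :
    zeroDigitCount (n + 1) x =
      zeroDigitCount n x + (if Int.fract ((2 : ℝ) ^ n * x) < 1 / 2 then 1 else 0) := by
  unfold zeroDigitCount
  rw [Finset.range_add_one, Finset.filter_insert]
  split_ifs with h
  · rw [Finset.card_insert_of_notMem (by simp)]
  · simp

theorem floor_succ_div (n : ℕ) (x : ℝ) :
    ⌊(2 : ℝ) ^ (n + 1) * x⌋₊ / 2 = ⌊(2 : ℝ) ^ n * x⌋₊ := by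
  rw [← Nat.floor_div_ofNat]
  congr 1
  rw [pow_succ]; ring

theorem fract_lt_half_iff (y : ℝ) (hy : 0 ≤ y) :
    Int.fract y < 1 / 2 ↔ ⌊2 * y⌋₊ % 2 = 0 := by
  have h1 : ⌊2 * y⌋₊ / 2 = ⌊y⌋₊ := by
    rw [← Nat.floor_div_ofNat]; congr 1; simp
  have h2 : (⌊y⌋₊ : ℝ) = y - Int.fract y := by
    rw [natCast_floor_eq_intCast_floor hy]
    exact (Int.self_sub_fract y).symm
  have h3 := Nat.floor_le (by positivity : 0 ≤ 2 * y)
  have h4 := Nat.lt_floor_add_one (2 * y)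
  have h5 := Nat.div_add_mod ⌊2 * y⌋₊ 2
  rw [h1] at h5
  have h6 : (⌊2 * y⌋₊ : ℝ) = 2 * (⌊y⌋₊ : ℝ) + ((⌊2 * y⌋₊ % 2 : ℕ) : ℝ) := by
    exact_mod_cast h5.symm
  constructor
  · intro h
    by_contra h7
    have h8 : ⌊2 * y⌋₊ % 2 = 1 := by omega
    rw [h8] at h6
    push_cast at h6
    linarith
  · intro h
    rw [h] at h6
    push_cast at h6
    linarith

theorem zeroDigitCount_eq (n : ℕ) (x : ℝ) (hx : 0 ≤ x) :
    zeroDigitCount n x = zc n ⌊(2 : ℝ) ^ n * x⌋₊ := by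
  induction n with
  | zero => simp [zeroDigitCount, zc]
  | succ n ih =>
    rw [zeroDigitCount_succ, zc, floor_succ_div, ← ih]
    congr 1
    have := fract_lt_half_iff ((2 : ℝ) ^ n * x) (by positivity)
    rw [← mul_assoc, ← pow_succ'] at this
    simp only [this]

theorem sum_range_two_mul {M : Type*} [AddCommMonoid M] (g : ℕ → M) (m : ℕ) :
    ∑ i ∈ Finset.range (2 * m), g i = ∑ i ∈ Finset.range m, (g (2 * i) + g (2 * i + 1)) := by
  induction m with
  | zero => simp
  | succ m ih =>
    rw [show 2 * (m + 1) = 2 * m + 1 + 1 by ring, Finset.sum_range_succ, Finset.sum_range_succ, ih,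
      Finset.sum_range_succ, add_assoc]

theorem sum_zc (c : ℝ) (n : ℕ) :
    ∑ j ∈ Finset.range (2 ^ n), c ^ (zc n j) = (1 + c) ^ n := by
  induction n with
  | zero => simp [zc]
  | succ n ih =>
    rw [pow_succ', sum_range_two_mul, pow_succ, ← ih, Finset.sum_mul]
    refine Finset.sum_congr rfl fun j _ => ?_
    have h1 : (2 * j + 1) / 2 = j := by omega
    have h2 : (2 * j) / 2 = j := by omega
    simp [zc, h1, h2, pow_succ]
    ring

/-- covering piece -/
def piece (t : ℝ) (n j : ℕ) : Set ℝ :=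
  {x : ℝ | |((2 : ℝ) ^ n * x - j) - x| < (2 : ℝ) ^ (-(t * (zc n j : ℝ)))}

theorem ediam_piece (t : ℝ) (n j : ℕ) (hn : 1 ≤ n) :
    Metric.ediam (piece t n j) ≤
      ENNReal.ofReal (4 * ((2 : ℝ) ^ (-(n : ℝ)) * (2 : ℝ) ^ (-(t * (zc n j : ℝ))))) := by
  refine Metric.ediam_le fun x hx y hy => ?_
  rw [edist_dist]
  apply ENNReal.ofReal_le_ofReal
  rw [Real.dist_eq]
  simp only [piece, Set.mem_ofPred_eq] at hx hy
  set r := (2 : ℝ) ^ (-(t * (zc n j : ℝ)))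
  have h2 : (2 : ℝ) ≤ 2 ^ n := by
    calc (2 : ℝ) = 2 ^ 1 := by simp
      _ ≤ 2 ^ n := pow_le_pow_right₀ (by norm_num) hn
  have h3 : |((2 : ℝ) ^ n - 1) * (x - y)| ≤ 2 * r := by
    rw [abs_lt] at hx hy
    rw [abs_le]
    constructor <;> nlinarith
  rw [abs_mul, abs_of_pos (by linarith)] at h3
  have h4 : (2 : ℝ) ^ n / 2 * |x - y| ≤ 2 * r := by
    refine le_trans ?_ h3
    gcongr
    linarith
  rw [Real.rpow_neg (by norm_num), Real.rpow_natCast]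
  have h5 : (0 : ℝ) < 2 ^ n := by positivity
  rw [show 4 * (((2 : ℝ) ^ n)⁻¹ * r) = (4 * r) / 2 ^ n by field_simp, le_div_iff₀ h5]
  linarith

theorem recSet_subset (t : ℝ) (m : ℕ) :
    recSet t ⊆ ⋃ i : (n : ℕ) × Fin (2 ^ (n + (m + 1))), piece t (i.1 + (m + 1)) i.2 := by
  rintro x ⟨hx, hf⟩
  obtain ⟨N, h, hN⟩ := (hf.and_eventually (eventually_ge_atTop (m + 1))).exists
  obtain ⟨n, rfl⟩ : ∃ n, N = n + (m + 1) := ⟨N - (m + 1), by omega⟩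
  set N := n + (m + 1)
  have hx0 := hx.1
  have hlt : ⌊(2 : ℝ) ^ N * x⌋₊ < 2 ^ N := by
    rw [Nat.floor_lt (by positivity)]
    push_cast
    have := hx.2
    nlinarith [show (0 : ℝ) < 2 ^ N by positivity]
  refine Set.mem_iUnion.2 ⟨⟨n, ⟨⌊(2 : ℝ) ^ N * x⌋₊, hlt⟩⟩, ?_⟩
  rw [iter_eq x hx, zeroDigitCount_eq _ _ hx.1] at h
  have h2 : (⌊(2 : ℝ) ^ N * x⌋₊ : ℝ) = (2 : ℝ) ^ N * x - Int.fract ((2 : ℝ) ^ N * x) := by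
    rw [natCast_floor_eq_intCast_floor (by positivity)]
    exact (Int.self_sub_fract _).symm
  simp only [piece, Set.mem_ofPred_eq]
  change |(2 : ℝ) ^ N * x - (⌊(2 : ℝ) ^ N * x⌋₊ : ℝ) - x| < _
  rw [h2]
  simpa using h

theorem upper_dim (t : ℝ) (ht : 0 ≤ t) (d : NNReal)
    (hd : (2 : ℝ) ^ (-(d : ℝ)) * (1 + (2 : ℝ) ^ (-(t * d))) < 1) :
    dimH (recSet t) ≤ d := by
  apply dimH_le_of_hausdorffMeasure_ne_top
  set ρ := (2 : ℝ) ^ (-(d : ℝ)) * (1 + (2 : ℝ) ^ (-(t * d))) with hρ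
  have hρ0 : 0 < ρ := by positivity
  have key := MeasureTheory.Measure.hausdorffMeasure_le_liminf_tsum (X := ℝ) (d : ℝ) (recSet t)
    (l := atTop) (ι := fun m : ℕ => (n : ℕ) × Fin (2 ^ (n + (m + 1))))
    (fun m : ℕ => ENNReal.ofReal (4 * (1 / 2 : ℝ) ^ m))
    (by
      rw [← ENNReal.ofReal_zero]
      apply ENNReal.tendsto_ofReal
      have := (tendsto_pow_atTop_nhds_zero_of_lt_one (r := (1 / 2 : ℝ)) (by norm_num)
        (by norm_num)).const_mul 4
      simpa using this)
    (fun m i => piece t (i.1 + (m + 1)) i.2)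
    (by
      refine Eventually.of_forall fun m i => ?_
      refine (ediam_piece t _ _ (by omega)).trans ?_
      apply ENNReal.ofReal_le_ofReal
      have h1 : (2 : ℝ) ^ (-(t * (zc (i.1 + (m + 1)) i.2 : ℝ))) ≤ 1 :=
        Real.rpow_le_one_of_one_le_of_nonpos (by norm_num) (by
          have : 0 ≤ t * (zc (i.1 + (m + 1)) i.2 : ℝ) := by positivity
          linarith)
      have h2 : (2 : ℝ) ^ (-((i.1 + (m + 1) : ℕ) : ℝ)) ≤ (1 / 2) ^ m := by
        rw [Real.rpow_neg (by norm_num), Real.rpow_natCast, one_div, inv_pow]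
        apply inv_anti₀ (by positivity)
        exact pow_le_pow_right₀ (by norm_num) (by omega)
      calc _ ≤ 4 * ((1 / 2 : ℝ) ^ m * 1) := by gcongr
        _ = _ := by ring)
    (Eventually.of_forall fun m => recSet_subset t m)
  have hbound : ∀ m : ℕ, (∑' i : (n : ℕ) × Fin (2 ^ (n + (m + 1))),
      Metric.ediam (piece t (i.1 + (m + 1)) i.2) ^ (d : ℝ)) ≤
      ENNReal.ofReal (4 ^ (d : ℝ)) * (1 - ENNReal.ofReal ρ)⁻¹ := by
    intro m
    rw [ENNReal.tsum_sigma (fun (n : ℕ) (j : Fin (2 ^ (n + (m + 1)))) =>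
      Metric.ediam (piece t (n + (m + 1)) j) ^ (d : ℝ)), ← ENNReal.tsum_geometric, ← ENNReal.tsum_mul_left]
    refine ENNReal.tsum_le_tsum fun n => ?_
    rw [tsum_fintype]
    set N := n + (m + 1)
    have h1 : ∀ j : Fin (2 ^ N), Metric.ediam (piece t N j) ^ (d : ℝ) ≤
        ENNReal.ofReal (4 ^ (d : ℝ) * ((2 : ℝ) ^ (-(d : ℝ))) ^ N *
          ((2 : ℝ) ^ (-(t * d))) ^ (zc N j)) := by
      intro j
      refine (ENNReal.rpow_le_rpow (ediam_piece t N j (by omega)) d.coe_nonneg).trans ?_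
      rw [ENNReal.ofReal_rpow_of_nonneg (by positivity) d.coe_nonneg]
      apply ENNReal.ofReal_le_ofReal
      rw [Real.mul_rpow (by norm_num) (by positivity), Real.mul_rpow (by positivity) (by positivity),
        ← Real.rpow_mul (by norm_num), ← Real.rpow_mul (by norm_num), ← Real.rpow_mul_natCast (by norm_num),
        ← Real.rpow_mul_natCast (by norm_num), mul_assoc]
      apply le_of_eq
      congr 3 <;> ring_nf
    refine (Finset.sum_le_sum fun j _ => h1 j).trans ?_
    rw [← ENNReal.ofReal_sum_of_nonneg (fun _ _ => by positivity), ← Finset.mul_sum,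
      Fin.sum_univ_eq_sum_range (fun j => ((2 : ℝ) ^ (-(t * d))) ^ (zc N j)) (2 ^ N), sum_zc,
      mul_assoc, ← mul_pow, ← hρ, ← ENNReal.ofReal_pow hρ0.le, ← ENNReal.ofReal_mul (by positivity)]
    apply ENNReal.ofReal_le_ofReal
    refine mul_le_mul_of_nonneg_left ?_ (by positivity)
    exact pow_le_pow_of_le_one hρ0.le hd.le (by omega)
  refine ne_top_of_le_ne_top (b := ENNReal.ofReal (4 ^ (d : ℝ)) * (1 - ENNReal.ofReal ρ)⁻¹) ?_ ?_
  · refine ENNReal.mul_ne_top ENNReal.ofReal_ne_top (ENNReal.inv_ne_top.2 ?_)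
    rw [← ENNReal.ofReal_one, ← ENNReal.ofReal_sub _ hρ0.le]
    simpa using hd
  · refine key.trans ?_
    refine (liminf_le_liminf (Eventually.of_forall hbound)).trans ?_
    simp

/-- number of zeros among the first `n` digits of a sequence -/
def zcnt (x : ℕ → Fin 2) (n : ℕ) : ℕ := ∑ i ∈ Finset.range n, (if x i = 0 then 1 else 0)

/-- length of the copied block -/
noncomputable def cpLen (t : ℝ) (x : ℕ → Fin 2) (N : ℕ) : ℕ := ⌈t * (zcnt x N : ℝ)⌉₊ + 1

/-- base position of the block containing `i` -/
def base (q i : ℕ) : ℕ := q ^ Nat.log q i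

/-- free positions -/
def isFree (t : ℝ) (q : ℕ) (x : ℕ → Fin 2) (i : ℕ) : Prop :=
  i ≠ 0 ∧ base q i + cpLen t x (base q i) ≤ i

theorem zcnt_congr {x y : ℕ → Fin 2} {n : ℕ} (h : ∀ i < n, x i = y i) : zcnt x n = zcnt y n := by
  unfold zcnt
  refine Finset.sum_congr rfl fun i hi => ?_
  rw [h i (Finset.mem_range.1 hi)]

theorem zcnt_le (x : ℕ → Fin 2) (n : ℕ) : zcnt x n ≤ n := by
  unfold zcnt
  calc _ ≤ ∑ i ∈ Finset.range n, 1 := Finset.sum_le_sum fun i _ => by split_ifs <;> simp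
    _ = n := by simp

theorem base_le {q i : ℕ} (hi : i ≠ 0) : base q i ≤ i := Nat.pow_log_le_self q hi

theorem base_eq {q k i : ℕ} (h1 : q ^ k ≤ i) (h2 : i < q ^ (k + 1)) : base q i = q ^ k := by
  unfold base; rw [Nat.log_eq_of_pow_le_of_lt_pow h1 h2]

theorem base_pos {q i : ℕ} (hq : 1 ≤ q) : 0 < base q i := by
  unfold base; positivity

theorem isFree_congr {t : ℝ} {q : ℕ} {x y : ℕ → Fin 2} {i : ℕ} (h : ∀ j < i, x j = y j) :
    isFree t q x i ↔ isFree t q y i := by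
  unfold isFree
  refine and_congr_right fun hi => ?_
  unfold cpLen
  rw [zcnt_congr (x := x) (y := y)]
  intro j hj
  exact h j (hj.trans_le (base_le hi))

theorem cpLen_le {t : ℝ} (ht : 0 ≤ t) (x : ℕ → Fin 2) (N : ℕ) :
    (cpLen t x N : ℝ) ≤ t * (zcnt x N : ℝ) + 2 := by
  unfold cpLen
  have := (Nat.ceil_lt_add_one (a := t * (zcnt x N : ℝ)) (by positivity)).le
  push_cast
  linarith

theorem le_cpLen (t : ℝ) (x : ℕ → Fin 2) (N : ℕ) :
    t * (zcnt x N : ℝ) + 1 ≤ (cpLen t x N : ℝ) := by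
  unfold cpLen
  have := Nat.le_ceil (t * (zcnt x N : ℝ))
  push_cast
  linarith

theorem add_cpLen_le' {t : ℝ} (ht : 0 ≤ t) (x : ℕ → Fin 2) {N : ℕ}
    (hN : 1 ≤ N) : ((N + cpLen t x N : ℕ) : ℝ) ≤ (t + 3) * N := by
  have h1 := cpLen_le ht x N
  have h2 : (zcnt x N : ℝ) ≤ N := by exact_mod_cast zcnt_le x N
  have h3 : (1 : ℝ) ≤ N := by exact_mod_cast hN
  push_cast
  nlinarith

theorem add_cpLen_le {t : ℝ} (ht : 0 ≤ t) {q : ℕ} (hq : t + 3 ≤ q) (x : ℕ → Fin 2) (k : ℕ) :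
    q ^ k + cpLen t x (q ^ k) ≤ q ^ (k + 1) := by
  have hq1 : 1 ≤ q := by
    have : (1 : ℝ) ≤ q := by linarith
    exact_mod_cast this
  have h := add_cpLen_le' ht x (Nat.one_le_pow k q hq1)
  have h2 : ((q ^ k + cpLen t x (q ^ k) : ℕ) : ℝ) ≤ ((q ^ (k + 1) : ℕ) : ℝ) := by
    refine h.trans ?_
    push_cast
    rw [pow_succ']
    gcongr
  exact_mod_cast h2

open Classical in
/-- The digit construction. -/
noncomputable def Fseq (t : ℝ) (q : ℕ) (ω : ℕ → Fin 2) : ℕ → Fin 2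
  | n => if n = 0 then 0 else
    if isFree t q (fun j => if _h : j < n then Fseq t q ω j else 0) n then ω n
    else if _h : n - base q n < n then Fseq t q ω (n - base q n) else 0
termination_by n => n
decreasing_by all_goals assumption

theorem Fseq_zero (t : ℝ) (q : ℕ) (ω : ℕ → Fin 2) : Fseq t q ω 0 = 0 := by
  rw [Fseq]; simp

theorem Fseq_free {t : ℝ} {q : ℕ} {ω : ℕ → Fin 2} {n : ℕ} (h : isFree t q (Fseq t q ω) n) :
    Fseq t q ω n = ω n := by
  have h0 : n ≠ 0 := h.1
  rw [isFree_congr (y := (fun j => if _h : j < n then Fseq t q ω j else 0))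
    (fun j hj => by simp [hj])] at h
  rw [Fseq, if_neg h0, if_pos h]

theorem Fseq_copy {t : ℝ} {q : ℕ} (hq : 1 ≤ q) {ω : ℕ → Fin 2} {n : ℕ} (h0 : n ≠ 0)
    (h : ¬ isFree t q (Fseq t q ω) n) :
    Fseq t q ω n = Fseq t q ω (n - base q n) := by
  rw [isFree_congr (y := (fun j => if _h : j < n then Fseq t q ω j else 0))
    (fun j hj => by simp [hj])] at h
  have := base_pos (i := n) hq
  rw [Fseq, if_neg h0, if_neg h, dif_pos (by omega)]

theorem Fseq_block {t : ℝ} (ht : 0 ≤ t) {q : ℕ} (hq : t + 3 ≤ q) (ω : ℕ → Fin 2) (k j : ℕ)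
    (hj : j < cpLen t (Fseq t q ω) (q ^ k)) :
    Fseq t q ω (j + q ^ k) = Fseq t q ω j := by
  have hq1 : 1 ≤ q := by
    have : (1 : ℝ) ≤ q := by linarith
    exact_mod_cast this
  have h1 := add_cpLen_le ht hq (Fseq t q ω) k
  have h2 : 0 < q ^ k := by positivity
  have hb : base q (j + q ^ k) = q ^ k := base_eq (by omega) (by omega)
  rw [Fseq_copy hq1 (by omega), hb, Nat.add_sub_cancel]
  rintro ⟨_, h⟩
  rw [hb] at h
  omega

theorem Fseq_congr {t : ℝ} {q : ℕ} (hq : 1 ≤ q) {ω ω' : ℕ → Fin 2} (n : ℕ)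
    (h : ∀ i ≤ n, ω i = ω' i) : Fseq t q ω n = Fseq t q ω' n := by
  induction n using Nat.strong_induction_on with
  | _ n ih =>
    have ih' : ∀ j < n, Fseq t q ω j = Fseq t q ω' j :=
      fun j hj => ih j hj fun i hi => h i (hi.trans hj.le)
    by_cases h0 : n = 0
    · subst h0; simp [Fseq_zero]
    by_cases hf : isFree t q (Fseq t q ω) n
    · rw [Fseq_free hf, Fseq_free ((isFree_congr ih').1 hf), h n le_rfl]
    · rw [Fseq_copy hq h0 hf, Fseq_copy hq h0 (fun h => hf ((isFree_congr ih').2 h))]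
      have := base_pos (i := n) hq
      exact ih' _ (by omega)

/-- cost of a digit -/
noncomputable def wt (s t : ℝ) (a : Fin 2) : ℝ := s + s * t * (if a = 0 then 1 else 0)

open Classical in
/-- free positions below `n` -/
noncomputable def freeSet (t : ℝ) (q : ℕ) (x : ℕ → Fin 2) (n : ℕ) : Finset ℕ :=
  (Finset.range n).filter (isFree t q x)

theorem cost_bound {s t d : ℝ} (ht : 0 ≤ t) (hd : 0 < d) (hds : d < s) {q : ℕ} (hq : t + 3 ≤ q)
    (hq2 : 2 * s + s * (1 + t) * (t + 3) ≤ (s - d) * q) (x : ℕ → Fin 2) (n : ℕ) :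
    d * n - d * q ≤ ∑ i ∈ freeSet t q x n, wt s t (x i) := by
  have hs : 0 < s := hd.trans hds
  have hw : ∀ a, s ≤ wt s t a := fun a => by
    unfold wt
    have : 0 ≤ s * t * (if a = 0 then 1 else 0) := by positivity
    linarith
  have hw0 : ∀ a, 0 ≤ wt s t a := fun a => hs.le.trans (hw a)
  have hq1 : 1 < q := by
    have : (1 : ℝ) < q := by linarith
    exact_mod_cast this
  rcases Nat.eq_zero_or_pos (Nat.log q n) with hk | hk
  · have hn : n < q := by
      rcases Nat.log_eq_zero_iff.1 hk with h | h
      · exact h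
      · omega
    have h1 : (n : ℝ) ≤ q := by exact_mod_cast hn.le
    have h2 : 0 ≤ ∑ i ∈ freeSet t q x n, wt s t (x i) := Finset.sum_nonneg fun i _ => hw0 _
    nlinarith
  obtain ⟨k, hk'⟩ : ∃ k, Nat.log q n = k + 1 := ⟨Nat.log q n - 1, by omega⟩
  have hn0 : n ≠ 0 := by rintro rfl; simp at hk
  have hNn : q ^ (k + 1) ≤ n := by rw [← hk']; exact Nat.pow_log_le_self q hn0
  have hnN : n < q ^ (k + 1 + 1) := by rw [← hk']; exact Nat.lt_pow_succ_log_self hq1 n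
  have hM := add_cpLen_le ht hq x k
  have hM2 := add_cpLen_le ht hq x (k + 1)
  have hMr := add_cpLen_le' ht x (Nat.one_le_pow k q hq1.le)
  have hN1 : 1 ≤ q ^ k := Nat.one_le_pow k q hq1.le
  have hNN : q ^ (k + 1) = q * q ^ k := pow_succ' q k
  have hNN' : (q : ℝ) ^ (k + 1) = q * q ^ k := pow_succ' _ k
  have hLr := cpLen_le ht x (q ^ (k + 1))
  have hLr2 := le_cpLen t x (q ^ (k + 1))
  set N' := q ^ k with hN'
  set N := q ^ (k + 1) with hN
  set M := N' + cpLen t x N' with hMdef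
  set M2 := N + cpLen t x N with hM2def
  have hsub : Finset.Ico M N ∪ Finset.Ico M2 n ⊆ freeSet t q x n := by
    intro i hi
    rw [Finset.mem_union, Finset.mem_Ico, Finset.mem_Ico] at hi
    simp only [freeSet, Finset.mem_filter, Finset.mem_range]
    rcases hi with hi | hi
    · have hb : base q i = N' := base_eq (by omega) hi.2
      refine ⟨by omega, by omega, ?_⟩
      rw [hb]; exact hi.1
    · have hb : base q i = N := base_eq (by omega) (by omega)
      refine ⟨by omega, by omega, ?_⟩
      rw [hb]; exact hi.1
  have hdisj : Disjoint (Finset.Ico M N) (Finset.Ico M2 n) := by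
    rw [Finset.disjoint_left]
    intro i hi hi'
    rw [Finset.mem_Ico] at hi hi'
    omega
  have h1 : ∑ i ∈ Finset.Ico M N, wt s t (x i) + ∑ i ∈ Finset.Ico M2 n, wt s t (x i) ≤
      ∑ i ∈ freeSet t q x n, wt s t (x i) := by
    rw [← Finset.sum_union hdisj]
    exact Finset.sum_le_sum_of_subset_of_nonneg hsub fun i _ _ => hw0 _
  have h2 : s * (N - M) + s * t * (zcnt x N - M) ≤ ∑ i ∈ Finset.Ico M N, wt s t (x i) := by
    have e1 : ∑ i ∈ Finset.Ico M N, wt s t (x i) =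
        s * (N - M) + s * t * ((zcnt x N : ℝ) - zcnt x M) := by
      rw [Finset.sum_Ico_eq_sub _ hM]
      simp only [wt, Finset.sum_add_distrib, ← Finset.mul_sum, zcnt]
      push_cast
      simp
      ring
    rw [e1]
    have e2 : (zcnt x M : ℝ) ≤ M := by exact_mod_cast zcnt_le x M
    have : 0 ≤ s * t := by positivity
    gcongr
  have h3 : 0 ≤ ∑ i ∈ Finset.Ico M2 n, wt s t (x i) := Finset.sum_nonneg fun i _ => hw0 _
  have h4 : s * (n - M2) ≤ ∑ i ∈ Finset.Ico M2 n, wt s t (x i) := by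
    calc s * ((n : ℝ) - M2) ≤ s * ((n - M2 : ℕ) : ℝ) := by
          gcongr
          rw [sub_le_iff_le_add]
          exact_mod_cast (by omega : n ≤ n - M2 + M2)
      _ = ∑ i ∈ Finset.Ico M2 n, s := by simp; ring
      _ ≤ _ := Finset.sum_le_sum fun i _ => hw _
  have hM2r : (M2 : ℝ) = N + cpLen t x N := by rw [hM2def]; push_cast; rfl
  have hN1r : (1 : ℝ) ≤ N' := by exact_mod_cast hN1
  have hNr : (N : ℝ) = q * N' := by exact_mod_cast hNN
  have hM2N : (N : ℝ) ≤ M2 := by rw [hM2r]; simp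
  have h5 : 2 * s + s * (1 + t) * M ≤ (s - d) * N := by
    calc 2 * s + s * (1 + t) * M ≤ 2 * s * N' + s * (1 + t) * ((t + 3) * N') := by
          have e1 : 2 * s ≤ 2 * s * N' := by nlinarith
          have e2 : s * (1 + t) * M ≤ s * (1 + t) * ((t + 3) * N') := by gcongr
          linarith
      _ = (2 * s + s * (1 + t) * (t + 3)) * N' := by ring
      _ ≤ ((s - d) * q) * N' := by gcongr
      _ = _ := by rw [hNr]; ring
  have h6 : s * M2 ≤ s * (N + t * zcnt x N + 2) := by
    rw [hM2r]; refine mul_le_mul_of_nonneg_left ?_ hs.le; linarith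
  have h7 : (s - d) * N ≤ (s - d) * M2 := by
    have : 0 ≤ s - d := by linarith
    gcongr
  have h8 : 0 < d * q := by positivity
  rcases le_total (n : ℝ) M2 with h | h
  · nlinarith
  · nlinarith

theorem ofDigits_step (x : ℕ → Fin 2) :
    2 * Real.ofDigits x = (x 0 : ℕ) + Real.ofDigits (fun i => x (i + 1)) := by
  rw [Real.ofDigits_eq_sum_add_ofDigits x 1]
  simp [Real.ofDigitsTerm]
  ring

theorem ofDigits_lt_one (m : ℕ) : ∀ (x : ℕ → Fin 2), x m = 0 → Real.ofDigits x < 1 := by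
  induction m with
  | zero =>
    intro x hx
    have h := ofDigits_step x
    have h1 := Real.ofDigits_le_one (fun i => x (i + 1))
    rw [hx] at h
    simp at h
    linarith
  | succ m ih =>
    intro x hx
    have h := ofDigits_step x
    have h1 := ih (fun i => x (i + 1)) hx
    have h2 : ((x 0 : ℕ) : ℝ) ≤ 1 := by
      have : (x 0 : ℕ) ≤ 1 := by omega
      exact_mod_cast this
    linarith

/-- the integer with given first `n` digits -/
def kn (x : ℕ → Fin 2) : ℕ → ℕ
  | 0 => 0
  | n + 1 => 2 * kn x n + (x n : ℕ)

theorem ofDigits_kn (x : ℕ → Fin 2) (n : ℕ) :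
    (2 : ℝ) ^ n * Real.ofDigits x = kn x n + Real.ofDigits (fun i => x (i + n)) := by
  induction n with
  | zero => simp [kn]
  | succ n ih =>
    have h := ofDigits_step (fun i => x (i + n))
    rw [pow_succ', mul_assoc, ih, mul_add, h, kn]
    push_cast
    simp only [zero_add, add_assoc, add_comm 1 n]

theorem kn_inj (x y : ℕ → Fin 2) (n : ℕ) (h : kn x n = kn y n) : ∀ i < n, x i = y i := by
  induction n with
  | zero => simp
  | succ n ih =>
    simp only [kn] at h
    have h1 : (x n : ℕ) < 2 := (x n).2
    have h2 : (y n : ℕ) < 2 := (y n).2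
    intro i hi
    rcases Nat.lt_succ_iff_lt_or_eq.1 hi with h3 | rfl
    · exact ih (by omega) i h3
    · exact Fin.ext (by omega)

theorem fract_ofDigits (x : ℕ → Fin 2) (hx : ∀ n, ∃ m ≥ n, x m = 0) (n : ℕ) :
    Int.fract ((2 : ℝ) ^ n * Real.ofDigits x) = Real.ofDigits (fun i => x (i + n)) := by
  rw [ofDigits_kn, ← Int.cast_natCast, Int.fract_intCast_add, Int.fract_eq_self]
  obtain ⟨m, hm, h⟩ := hx n
  exact ⟨Real.ofDigits_nonneg _, ofDigits_lt_one (m - n) _ (by simpa [Nat.sub_add_cancel hm] using h)⟩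

theorem zeroDigitCount_ofDigits (x : ℕ → Fin 2) (hx : ∀ n, ∃ m ≥ n, x m = 0) (n : ℕ) :
    zeroDigitCount n (Real.ofDigits x) = zcnt x n := by
  unfold zeroDigitCount zcnt
  rw [Finset.card_filter]
  refine Finset.sum_congr rfl fun i _ => ?_
  rw [fract_ofDigits x hx]
  have h := ofDigits_step (fun j => x (j + i))
  simp only [zero_add] at h
  have h0 := Real.ofDigits_nonneg (fun j => x (j + 1 + i))
  obtain ⟨m, hm, hm0⟩ := hx (i + 1)
  have h1 := ofDigits_lt_one (m - (i + 1)) (fun j => x (j + 1 + i)) (by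
    have : m - (i + 1) + 1 + i = m := by omega
    simpa [this] using hm0)
  congr 1
  rw [eq_iff_iff]
  constructor
  · intro h2
    by_contra h3
    have h4 : (x i : ℕ) = 1 := by
      have := (x i).2
      have h5 : (x i : ℕ) ≠ 0 := fun h6 => h3 (Fin.ext h6)
      omega
    rw [h4] at h
    push_cast at h
    linarith
  · intro h2
    rw [h2] at h
    simp at h
    linarith

theorem Fseq_zeros {t : ℝ} (ht : 0 ≤ t) {q : ℕ} (hq : t + 3 ≤ q) (ω : ℕ → Fin 2) (n : ℕ) :
    ∃ m ≥ n, Fseq t q ω m = 0 := by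
  have hq1 : 1 < q := by
    have : (1 : ℝ) < q := by linarith
    exact_mod_cast this
  refine ⟨q ^ n, (Nat.lt_pow_self hq1).le, ?_⟩
  have := Fseq_block ht hq ω n 0 (by simp [cpLen])
  rw [zero_add] at this
  rw [this, Fseq_zero]

theorem Fseq_mem {t : ℝ} (ht : 0 ≤ t) {q : ℕ} (hq : t + 3 ≤ q) (ω : ℕ → Fin 2) :
    Real.ofDigits (Fseq t q ω) ∈ recSet t := by
  have hq1 : 1 < q := by
    have : (1 : ℝ) < q := by linarith
    exact_mod_cast this
  have hz := Fseq_zeros ht hq ω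
  have hI : Real.ofDigits (Fseq t q ω) ∈ Set.Ico (0 : ℝ) 1 :=
    ⟨Real.ofDigits_nonneg _, ofDigits_lt_one 0 _ (Fseq_zero t q ω)⟩
  refine ⟨hI, ?_⟩
  rw [frequently_atTop]
  intro n
  refine ⟨q ^ n, (Nat.lt_pow_self hq1).le, ?_⟩
  rw [iter_eq _ hI, fract_ofDigits _ hz, zeroDigitCount_ofDigits _ hz]
  refine (Real.abs_ofDigits_sub_ofDigits_le
    (fun i hi => Fseq_block ht hq ω n i hi)).trans_lt ?_
  have := le_cpLen t (Fseq t q ω) (q ^ n)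
  rw [← Real.rpow_natCast, ← Real.rpow_neg (by norm_num)]
  push_cast
  apply Real.rpow_lt_rpow_of_exponent_lt (by norm_num)
  linarith

open MeasureTheory

theorem measurable_Fseq (t : ℝ) {q : ℕ} (hq : 1 ≤ q) : Measurable (Fseq t q) := by
  rw [measurable_pi_iff]
  intro n
  have h : (fun ω => Fseq t q ω n) =
      (fun g : (Finset.range (n + 1) → Fin 2) =>
        Fseq t q (fun i => if h : i ∈ Finset.range (n + 1) then g ⟨i, h⟩ else 0) n) ∘
      (Finset.range (n + 1)).restrict := by
    funext ω
    simp only [Function.comp]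
    apply Fseq_congr hq
    intro i hi
    have : i < n + 1 := by omega
    simp [this]
  rw [h]
  exact (measurable_of_finite _).comp (Finset.measurable_restrict _)

/-- digit measure -/
noncomputable def dm (s t : ℝ) : Measure (Fin 2) :=
  ENNReal.ofReal ((2 : ℝ) ^ (-(wt s t 0))) • Measure.dirac 0 +
    ENNReal.ofReal ((2 : ℝ) ^ (-(wt s t 1))) • Measure.dirac 1

theorem dm_singleton (s t : ℝ) (a : Fin 2) :
    dm s t {a} = ENNReal.ofReal ((2 : ℝ) ^ (-(wt s t a))) := by
  unfold dm
  fin_cases a <;> simp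

theorem dm_prob {s t : ℝ} (hs : (2 : ℝ) ^ (-(s * (1 + t))) + (2 : ℝ) ^ (-s) = 1) :
    IsProbabilityMeasure (dm s t) := by
  constructor
  unfold dm
  simp only [Measure.coe_add, Measure.coe_smul, Pi.add_apply, Pi.smul_apply, measure_univ,
    smul_eq_mul, mul_one]
  rw [← ENNReal.ofReal_add (by positivity) (by positivity), ← ENNReal.ofReal_one, ← hs]
  simp [wt, mul_add]

theorem cyl_bound {s t d : ℝ} (ht : 0 ≤ t) (hd : 0 < d) (hds : d < s) {q : ℕ} (hq : t + 3 ≤ q)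
    (hq2 : 2 * s + s * (1 + t) * (t + 3) ≤ (s - d) * q) [IsProbabilityMeasure (dm s t)]
    (ω₀ : ℕ → Fin 2) (n : ℕ) :
    Measure.infinitePi (fun _ : ℕ => dm s t)
      {ω | ∀ i < n, Fseq t q ω i = Fseq t q ω₀ i} ≤
      ENNReal.ofReal ((2 : ℝ) ^ (d * q - d * n)) := by
  set x := Fseq t q ω₀ with hx
  have hsub : {ω | ∀ i < n, Fseq t q ω i = x i} ⊆
      Set.pi (freeSet t q x n : Finset ℕ) (fun i => {x i}) := by
    intro ω hω i hi
    simp only [freeSet, Finset.coe_filter, Finset.mem_range, Set.mem_ofPred_eq] at hi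
    rw [Set.mem_singleton_iff, ← hω i hi.1, Fseq_free]
    rw [isFree_congr (y := x) (fun j hj => hω j (hj.trans hi.1))]
    exact hi.2
  refine (measure_mono hsub).trans ?_
  rw [Measure.infinitePi_pi _ (fun i _ => measurableSet_singleton _)]
  simp only [dm_singleton]
  rw [← ENNReal.ofReal_prod_of_nonneg (fun _ _ => by positivity),
    ← Real.rpow_sum_of_pos (by norm_num)]
  apply ENNReal.ofReal_le_ofReal
  apply Real.rpow_le_rpow_of_exponent_le (by norm_num)
  rw [Finset.sum_neg_distrib]
  have := cost_bound ht hd hds hq hq2 x n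
  linarith

theorem set_bound {s t d : ℝ} (ht : 0 ≤ t) (hd : 0 < d) (hds : d < s) {q : ℕ} (hq : t + 3 ≤ q)
    (hq2 : 2 * s + s * (1 + t) * (t + 3) ≤ (s - d) * q) [IsProbabilityMeasure (dm s t)]
    (U : Set ℝ) (n : ℕ) (hU : Metric.ediam U ≤ ENNReal.ofReal (((2 : ℝ) ^ n)⁻¹)) :
    Measure.infinitePi (fun _ : ℕ => dm s t)
      ((fun ω => Real.ofDigits (Fseq t q ω)) ⁻¹' U) ≤
      5 * ENNReal.ofReal ((2 : ℝ) ^ (d * q - d * n)) := by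
  set P := Measure.infinitePi (fun _ : ℕ => dm s t)
  set S := ((fun ω => Real.ofDigits (Fseq t q ω)) ⁻¹' U) with hS
  have hc : ∀ k : ℕ, P {ω | kn (Fseq t q ω) n = k} ≤
      ENNReal.ofReal ((2 : ℝ) ^ (d * q - d * n)) := by
    intro k
    rcases Set.eq_empty_or_nonempty {ω | kn (Fseq t q ω) n = k} with h | ⟨ω₀, h⟩
    · rw [h]; simp
    · refine (measure_mono ?_).trans (cyl_bound ht hd hds hq hq2 ω₀ n)
      intro ω hω
      exact kn_inj _ _ n (Eq.trans hω (Eq.symm h))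
  rcases Set.eq_empty_or_nonempty S with h | ⟨ω₀, h⟩
  · rw [h]; simp
  set k₀ := kn (Fseq t q ω₀) n with hk0
  have hsub : S ⊆ ⋃ j ∈ Finset.range 5, {ω | kn (Fseq t q ω) n = k₀ + j - 2} := by
    intro ω hω
    have h1 : edist (Real.ofDigits (Fseq t q ω)) (Real.ofDigits (Fseq t q ω₀)) ≤
        ENNReal.ofReal (((2 : ℝ) ^ n)⁻¹) := (Metric.edist_le_ediam_of_mem (s := U) hω h).trans hU
    rw [edist_dist, ENNReal.ofReal_le_ofReal_iff (by positivity), Real.dist_eq] at h1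
    have h2 : |(2 : ℝ) ^ n * Real.ofDigits (Fseq t q ω) -
        (2 : ℝ) ^ n * Real.ofDigits (Fseq t q ω₀)| ≤ 1 := by
      rw [← mul_sub, abs_mul, abs_of_pos (by positivity)]
      calc _ ≤ (2 : ℝ) ^ n * ((2 : ℝ) ^ n)⁻¹ := by gcongr
        _ = 1 := by field_simp
    rw [ofDigits_kn, ofDigits_kn, ← hk0, abs_le] at h2
    have a1 := Real.ofDigits_nonneg (fun i => Fseq t q ω (i + n))
    have a2 := Real.ofDigits_nonneg (fun i => Fseq t q ω₀ (i + n))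
    have a3 := Real.ofDigits_le_one (fun i => Fseq t q ω (i + n))
    have a4 := Real.ofDigits_le_one (fun i => Fseq t q ω₀ (i + n))
    have b1 : kn (Fseq t q ω) n ≤ k₀ + 2 := by
      have : (kn (Fseq t q ω) n : ℝ) ≤ k₀ + 2 := by linarith
      exact_mod_cast this
    have b2 : k₀ ≤ kn (Fseq t q ω) n + 2 := by
      have : (k₀ : ℝ) ≤ kn (Fseq t q ω) n + 2 := by linarith
      exact_mod_cast this
    simp only [Set.mem_iUnion, Finset.mem_range, Set.mem_ofPred_eq, exists_prop]
    exact ⟨kn (Fseq t q ω) n + 2 - k₀, by omega, by omega⟩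
  refine (measure_mono hsub).trans ((measure_biUnion_finset_le _ _).trans ?_)
  refine (Finset.sum_le_sum fun j _ => hc _).trans ?_
  simp

theorem lower_dim {s t : ℝ} (ht : 0 ≤ t)
    (hs : (2 : ℝ) ^ (-(s * (1 + t))) + (2 : ℝ) ^ (-s) = 1) (d : NNReal) (hd : 0 < d)
    (hds : (d : ℝ) < s) : (d : ENNReal) ≤ dimH (recSet t) := by
  have hd' : 0 < (d : ℝ) := hd
  obtain ⟨q, hq⟩ := exists_nat_ge (max (t + 3) ((2 * s + s * (1 + t) * (t + 3)) / (s - d)))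
  have hq1 := (le_max_left _ _).trans hq
  have hq2 := (le_max_right _ _).trans hq
  rw [div_le_iff₀ (by linarith), mul_comm (q : ℝ)] at hq2
  have hq0 : 1 ≤ q := by
    have : (1 : ℝ) ≤ q := by linarith
    exact_mod_cast this
  have := dm_prob hs
  set P := Measure.infinitePi (fun _ : ℕ => dm s t)
  set f : (ℕ → Fin 2) → ℝ := fun ω => Real.ofDigits (Fseq t q ω)
  have hf : Measurable f := Real.continuous_ofDigits.measurable.comp (measurable_Fseq t hq0)
  set K : ℝ := 5 * 2 ^ ((d : ℝ) * q) * 2 ^ (d : ℝ) with hK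
  have hK0 : 0 < K := by positivity
  have hmain : ∀ U : Set ℝ, Metric.ediam U ≤ 1 →
      P.map f U ≤ ENNReal.ofReal K * Metric.ediam U ^ (d : ℝ) := by
    intro U hU
    have hcl : P.map f U ≤ P (f ⁻¹' closure U) := by
      rw [← Measure.map_apply hf isClosed_closure.measurableSet]
      exact measure_mono subset_closure
    have hb : ∀ n : ℕ, Metric.ediam U ≤ ENNReal.ofReal (((2 : ℝ) ^ n)⁻¹) →
        P.map f U ≤ 5 * ENNReal.ofReal ((2 : ℝ) ^ ((d : ℝ) * q - d * n)) := fun n hn =>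
      hcl.trans (set_bound ht hd' hds hq1 hq2 (closure U) n (by rwa [Metric.ediam_closure]))
    have hne : Metric.ediam U ≠ ⊤ := ne_top_of_le_ne_top ENNReal.one_ne_top hU
    obtain ⟨r, hr0, hr⟩ : ∃ r : ℝ, 0 ≤ r ∧ Metric.ediam U = ENNReal.ofReal r :=
      ⟨_, ENNReal.toReal_nonneg, (ENNReal.ofReal_toReal hne).symm⟩
    rw [hr] at hU hb ⊢
    have hr1 : r ≤ 1 := by simpa using hU
    rcases hr0.eq_or_lt with h0 | h0
    · subst h0
      rw [ENNReal.ofReal_zero, ENNReal.zero_rpow_of_pos hd', mul_zero]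
      refine ge_of_tendsto (x := atTop) (f := fun n : ℕ =>
        5 * ENNReal.ofReal ((2 : ℝ) ^ ((d : ℝ) * q - d * n))) ?_
        (Eventually.of_forall fun n => hb n (by simp))
      have h1 : Tendsto (fun n : ℕ => (2 : ℝ) ^ ((d : ℝ) * q - d * n)) atTop (nhds 0) := by
        have h2 : ∀ n : ℕ, (2 : ℝ) ^ ((d : ℝ) * q - d * n) =
            2 ^ ((d : ℝ) * q) * ((2 : ℝ) ^ (-(d : ℝ))) ^ n := by
          intro n
          rw [← Real.rpow_mul_natCast (by norm_num), ← Real.rpow_add (by norm_num)]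
          congr 1; ring
        simp only [h2]
        have h3 : (2 : ℝ) ^ (-(d : ℝ)) < 1 :=
          Real.rpow_lt_one_of_one_lt_of_neg (by norm_num) (by linarith)
        simpa using (tendsto_pow_atTop_nhds_zero_of_lt_one (by positivity) h3).const_mul
          ((2 : ℝ) ^ ((d : ℝ) * q))
      have h4 := ENNReal.Tendsto.const_mul (a := 5) (ENNReal.tendsto_ofReal h1)
        (Or.inr (by simp))
      simpa using h4
    · obtain ⟨n, hn1, hn2⟩ := exists_nat_pow_near_of_lt_one h0 hr1
        (by norm_num : (0 : ℝ) < 1 / 2) (by norm_num)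
      refine (hb n (ENNReal.ofReal_le_ofReal (by simpa using hn2))).trans ?_
      rw [ENNReal.ofReal_rpow_of_pos h0, ← ENNReal.ofReal_mul hK0.le,
        show (5 : ENNReal) = ENNReal.ofReal 5 by simp, ← ENNReal.ofReal_mul (by norm_num)]
      apply ENNReal.ofReal_le_ofReal
      have h5 : ((1 / 2 : ℝ) ^ (n + 1)) ^ (d : ℝ) ≤ r ^ (d : ℝ) :=
        Real.rpow_le_rpow (by positivity) hn1.le hd'.le
      have h6 : ((1 / 2 : ℝ) ^ (n + 1)) ^ (d : ℝ) = 2 ^ (-(d * n + d) : ℝ) := by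
        rw [one_div, inv_pow, ← Real.rpow_natCast, ← Real.rpow_neg (by norm_num),
          ← Real.rpow_mul (by norm_num)]
        congr 1; push_cast; ring
      calc 5 * (2 : ℝ) ^ ((d : ℝ) * q - d * n) = K * 2 ^ (-(d * n + d) : ℝ) := by
            rw [hK, mul_assoc, mul_assoc, ← Real.rpow_add (by norm_num),
              ← Real.rpow_add (by norm_num)]
            congr 2; ring
        _ ≤ K * r ^ (d : ℝ) := by rw [← h6]; gcongr
  have hle := Measure.le_hausdorffMeasure (X := ℝ) (d : ℝ) ((ENNReal.ofReal K)⁻¹ • P.map f) 1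
    one_pos (fun U hU => by
      rw [Measure.smul_apply, smul_eq_mul]
      rw [ENNReal.inv_mul_le_iff (by simpa using hK0) ENNReal.ofReal_ne_top]
      exact hmain U hU)
  apply le_dimH_of_hausdorffMeasure_ne_zero
  have h1 : 1 ≤ P.map f (recSet t) := by
    refine le_trans ?_ (Measure.le_map_apply hf.aemeasurable _)
    have : f ⁻¹' recSet t = Set.univ := Set.eq_univ_of_forall fun ω => Fseq_mem ht hq1 ω
    rw [this, measure_univ]
  have h2 := hle (recSet t)
  rw [Measure.smul_apply, smul_eq_mul] at h2
  have h3 : 0 < (ENNReal.ofReal K)⁻¹ * P.map f (recSet t) := by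
    refine ENNReal.mul_pos (by simp) (by
      intro h; rw [h] at h1; simp at h1)
  exact ne_of_gt (h3.trans_le h2)

/-- For the doubling map `T x = 2x mod 1` and `t ≥ 0`, the Hausdorff dimension
of the set of `x` with `|T^n x − x| < 2^{-t ξ_n(x)}` infinitely often, where `ξ_n(x)` is the
number of zeros among the first `n` dyadic digits of `x`, equals the unique solution `s` of
`1 + 2^{ts} = 2^{s(t+1)}`. -/
theorem doubling_recurrence_dimH (t : ℝ) (ht : 0 ≤ t) (s : ℝ)
    (hs : 1 + (2 : ℝ) ^ (t * s) = (2 : ℝ) ^ (s * (t + 1))) :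
    dimH {x : ℝ | x ∈ Set.Ico (0 : ℝ) 1 ∧
        ∃ᶠ n : ℕ in atTop,
          |(fun y : ℝ => Int.fract (2 * y))^[n] x - x| <
            (2 : ℝ) ^ (-(t * (zeroDigitCount n x : ℝ)))} =
      ENNReal.ofReal s := by
  change dimH (recSet t) = _
  have hs' : (2 : ℝ) ^ (-(s * (1 + t))) + (2 : ℝ) ^ (-s) = 1 := by
    have h1 : (2 : ℝ) ^ (-s) = 2 ^ (t * s) * 2 ^ (-(s * (1 + t))) := by
      rw [← Real.rpow_add (by norm_num)]; congr 1; ring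
    have h2 : (2 : ℝ) ^ (s * (t + 1)) * 2 ^ (-(s * (1 + t))) = 1 := by
      rw [← Real.rpow_add (by norm_num)]
      rw [show s * (t + 1) + -(s * (1 + t)) = 0 by ring, Real.rpow_zero]
    rw [← hs] at h2
    rw [h1]; linarith
  have hspos : 0 < s := by
    by_contra h
    have h1 : 1 ≤ (2 : ℝ) ^ (-s) := Real.one_le_rpow (by norm_num) (by linarith)
    have h2 : 0 < (2 : ℝ) ^ (-(s * (1 + t))) := by positivity
    linarith
  apply le_antisymm
  · apply le_of_forall_gt_imp_ge_of_dense
    intro b hb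
    obtain ⟨d, hd1, hd2⟩ := ENNReal.lt_iff_exists_nnreal_btwn.1 hb
    have hsd : s < d := by
      rwa [← ENNReal.ofReal_coe_nnreal, ENNReal.ofReal_lt_ofReal_iff_of_nonneg hspos.le] at hd1
    refine (upper_dim t ht d ?_).trans hd2.le
    rw [mul_add, mul_one, ← Real.rpow_add (by norm_num), ← hs', add_comm]
    apply add_lt_add
    · apply Real.rpow_lt_rpow_of_exponent_lt (by norm_num)
      nlinarith
    · apply Real.rpow_lt_rpow_of_exponent_lt (by norm_num)
      linarith
  · apply le_of_forall_lt_imp_le_of_dense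
    intro b hb
    obtain ⟨d, hd1, hd2⟩ := ENNReal.lt_iff_exists_nnreal_btwn.1 hb
    have hsd : (d : ℝ) < s := by
      rwa [← ENNReal.ofReal_coe_nnreal, ENNReal.ofReal_lt_ofReal_iff hspos] at hd2
    have hd0 : 0 < d := by
      have := (zero_le (a := b)).trans_lt hd1
      exact_mod_cast this
    exact hd1.le.trans (lower_dim ht hs' d hd0 hsd)
end

section
/- Let C be the middle-thirds Cantor set and T : C → C the map Tx = 3x mod 1. For any t > 0, the Hausdorff dimension of the set {x ∈ C : |T^n x − x| < 3^{-tn} for infinitely many n ∈ ℕ} is (log 2 / log 3)/(t+1). -/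
open Filter

namespace CantorRec

/-- End of the block of forced digits starting at `M ^ j`. -/
noncomputable def blockEnd (t : ℝ) (M j : ℕ) : ℕ := M ^ j + (⌈t * (M : ℝ) ^ j⌉₊ + 1)

/-- Positions at which the digit is forced to copy an earlier one. -/
def Forced (t : ℝ) (M p : ℕ) : Prop := M ≤ p ∧ p < blockEnd t M (Nat.log M p)

/-- Positions with free digits. -/
def Free (t : ℝ) (M p : ℕ) : Prop := p ≠ 0 ∧ ¬ Forced t M p

open Classical in
/-- The digit sequence with prescribed free digits. -/
noncomputable def seq (t : ℝ) (M : ℕ) (b : ℕ → Bool) (p : ℕ) : Bool :=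
  if _h0 : p = 0 then false
  else if _hp : M = 0 then false
  else if Forced t M p then seq t M b (p - M ^ Nat.log M p)
  else b (Nat.count (Free t M) p)
termination_by p
decreasing_by
  have : 0 < M ^ Nat.log M p := Nat.pow_pos (Nat.pos_of_ne_zero _hp)
  omega

lemma blockEnd_mono {t : ℝ} (ht : 0 < t) {M i j : ℕ} (hM : 1 ≤ M) (h : i ≤ j) :
    blockEnd t M i ≤ blockEnd t M j := by
  have h1 : M ^ i ≤ M ^ j := Nat.pow_le_pow_right hM h
  have h2 : (M : ℝ) ^ i ≤ (M : ℝ) ^ j := by exact_mod_cast h1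
  have h3 : ⌈t * (M : ℝ) ^ i⌉₊ ≤ ⌈t * (M : ℝ) ^ j⌉₊ := Nat.ceil_mono (by gcongr)
  unfold blockEnd
  omega

lemma blockEnd_le {t : ℝ} (ht : 0 < t) (M j : ℕ) :
    (blockEnd t M j : ℝ) ≤ (1 + t) * (M : ℝ) ^ j + 2 := by
  have := Nat.ceil_lt_add_one (a := t * (M : ℝ) ^ j) (by positivity)
  unfold blockEnd
  push_cast
  linarith

lemma blockEnd_le_pow {t : ℝ} (ht : 0 < t) {M : ℕ} (hM : 3 + t ≤ M) (j : ℕ) :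
    blockEnd t M j ≤ M ^ (j + 1) := by
  have h := blockEnd_le ht M j
  have h1 : (1 : ℝ) ≤ (M : ℝ) ^ j := one_le_pow₀ (by linarith)
  have : (blockEnd t M j : ℝ) ≤ (M : ℝ) ^ (j + 1) := by
    rw [pow_succ]; nlinarith
  exact_mod_cast this

lemma two_le {t : ℝ} (ht : 0 < t) {M : ℕ} (hM : 3 + t ≤ M) : 2 ≤ M := by
  have : (2 : ℝ) ≤ M := by linarith
  exact_mod_cast this

lemma free_of {t : ℝ} (ht : 0 < t) {M : ℕ} (hM : 3 + t ≤ M) {i x : ℕ}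
    (h1 : blockEnd t M i ≤ x) (h2 : x < M ^ (i + 1)) : Free t M x := by
  have hM2 := two_le ht hM
  refine ⟨?_, ?_⟩
  · rintro rfl
    simp [blockEnd] at h1
  · rintro ⟨_, h⟩
    have hx : x ≠ 0 := by
      rintro rfl
      simp [blockEnd] at h1
    have := Nat.log_lt_of_lt_pow hx h2
    have := blockEnd_mono ht (M := M) (by omega) (Nat.lt_succ_iff.1 this)
    omega

open Classical in
lemma count_free {t : ℝ} (ht : 0 < t) {M : ℕ} (hM : 3 + t ≤ M) {κ : ℝ} (hκ : 0 < κ)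
    (h : (1 + t) * (κ + 1 / M) ≤ 1) (p : ℕ) :
    κ * p - 5 ≤ Nat.count (Free t M) p := by
  have hM2 := two_le ht hM
  have hM0 : (0 : ℝ) < M := by linarith
  have hκ1 : κ ≤ 1 := by
    have : 0 < 1 / (M : ℝ) := by positivity
    nlinarith
  rw [Nat.count_eq_card_filter_range]
  rcases lt_or_ge p M with hp | hp
  · have hsub : Finset.Ico 1 p ⊆ (Finset.range p).filter (Free t M) := by
      intro x hx
      simp only [Finset.mem_Ico] at hx
      simp only [Finset.mem_filter, Finset.mem_range]
      refine ⟨hx.2, by omega, fun hf => ?_⟩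
      have := hf.1
      omega
    have h1 := Finset.card_le_card hsub
    rw [Nat.card_Ico] at h1
    have h2 : p ≤ ((Finset.range p).filter (Free t M)).card + 1 := by omega
    have h3 : (p : ℝ) ≤ ((Finset.range p).filter (Free t M)).card + 1 := by exact_mod_cast h2
    have : κ * p ≤ 1 * p := by gcongr
    linarith
  · obtain ⟨j, hj⟩ : ∃ j, Nat.log M p = j + 1 :=
      Nat.exists_eq_succ_of_ne_zero (Nat.log_pos (by omega) hp).ne'
    have hN : M ^ (j + 1) ≤ p := by
      rw [← hj]; exact Nat.pow_log_le_self M (by omega)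
    have hN2 : p < M ^ (j + 1 + 1) := by
      rw [← hj]; exact Nat.lt_pow_succ_log_self (by omega) p
    have hNB : M ^ (j + 1) ≤ blockEnd t M (j + 1) := by unfold blockEnd; omega
    have hsub : Finset.Ico (blockEnd t M j) (M ^ (j + 1)) ∪ Finset.Ico (blockEnd t M (j + 1)) p
        ⊆ (Finset.range p).filter (Free t M) := by
      intro x hx
      simp only [Finset.mem_union, Finset.mem_Ico] at hx
      simp only [Finset.mem_filter, Finset.mem_range]
      rcases hx with hx | hx
      · exact ⟨by omega, free_of ht hM hx.1 hx.2⟩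
      · exact ⟨by omega, free_of ht hM hx.1 (by omega)⟩
    have hdisj : Disjoint (Finset.Ico (blockEnd t M j) (M ^ (j + 1)))
        (Finset.Ico (blockEnd t M (j + 1)) p) := by
      rw [Finset.disjoint_left]
      intro x hx hx'
      simp only [Finset.mem_Ico] at hx hx'
      omega
    have h1 := Finset.card_le_card hsub
    rw [Finset.card_union_of_disjoint hdisj, Nat.card_Ico, Nat.card_Ico] at h1
    set c := ((Finset.range p).filter (Free t M)).card
    have hE := blockEnd_le ht M j
    have hB := blockEnd_le ht M (j + 1)
    have h2 : M ^ (j + 1) ≤ c + blockEnd t M j := by omega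
    have h3 : M ^ (j + 1) + p ≤ c + blockEnd t M j + blockEnd t M (j + 1) := by
      have := blockEnd_le_pow ht hM j
      omega
    have h2' : (M : ℝ) ^ (j + 1) ≤ c + blockEnd t M j := by exact_mod_cast h2
    have h3' : (M : ℝ) ^ (j + 1) + p ≤ c + blockEnd t M j + blockEnd t M (j + 1) := by
      exact_mod_cast h3
    have h4 : (M : ℝ) ^ (j + 1) + κ * (p - blockEnd t M (j + 1)) ≤ c + blockEnd t M j := by
      rcases le_total (p : ℝ) (blockEnd t M (j + 1)) with h | h <;> nlinarith
    have h5 : (M : ℝ) ^ j = (M : ℝ) ^ (j + 1) * (1 / M) := by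
      rw [pow_succ]; field_simp
    have h6 : (0 : ℝ) < (M : ℝ) ^ (j + 1) := by positivity
    have h7 : κ * blockEnd t M (j + 1) ≤ κ * ((1 + t) * (M : ℝ) ^ (j + 1) + 2) := by gcongr
    rw [h5] at hE
    have h8 := mul_le_mul_of_nonneg_left h h6.le
    nlinarith

open Classical in
lemma free_infinite {t : ℝ} (ht : 0 < t) {M : ℕ} (hM : 3 + t ≤ M) {κ : ℝ} (hκ : 0 < κ)
    (h : (1 + t) * (κ + 1 / M) ≤ 1) : (Set.ofPred (Free t M)).Infinite := by
  intro hf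
  obtain ⟨p, hp⟩ := exists_nat_gt ((hf.toFinset.card + 5 : ℝ) / κ)
  rw [div_lt_iff₀ hκ] at hp
  have h1 := count_free ht hM hκ h p
  have h2 : (Nat.count (Free t M) p : ℝ) ≤ hf.toFinset.card := by
    exact_mod_cast Nat.count_le_card hf p
  linarith

lemma seq_zero (t : ℝ) (M : ℕ) (b : ℕ → Bool) : seq t M b 0 = false := by
  rw [seq]; simp

lemma seq_copy {t : ℝ} (ht : 0 < t) {M : ℕ} (hM : 3 + t ≤ M) (b : ℕ → Bool) (j i : ℕ)
    (hi : i < ⌈t * (M : ℝ) ^ (j + 1)⌉₊ + 1) : seq t M b (i + M ^ (j + 1)) = seq t M b i := by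
  have hM2 := two_le ht hM
  have h0 : 0 < M ^ (j + 1) := Nat.pow_pos (by omega)
  have hB := blockEnd_le_pow ht hM (j + 1)
  have hlt : i + M ^ (j + 1) < blockEnd t M (j + 1) := by unfold blockEnd; omega
  have hlog : Nat.log M (i + M ^ (j + 1)) = j + 1 :=
    Nat.log_eq_of_pow_le_of_lt_pow (by omega) (by omega)
  have hf : Forced t M (i + M ^ (j + 1)) := by
    refine ⟨?_, by rwa [hlog]⟩
    have : M ^ 1 ≤ M ^ (j + 1) := Nat.pow_le_pow_right (by omega) (by omega)
    rw [pow_one] at this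
    omega
  rw [seq, dif_neg (by omega), dif_neg (by omega), if_pos hf, hlog, Nat.add_sub_cancel]

open Classical in
lemma seq_free {t : ℝ} (ht : 0 < t) {M : ℕ} (hM : 3 + t ≤ M) (b : ℕ → Bool) (p : ℕ)
    (hp : Free t M p) : seq t M b p = b (Nat.count (Free t M) p) := by
  have hM2 := two_le ht hM
  rw [seq, dif_neg hp.1, dif_neg (by omega), if_neg hp.2]

/-- The coding map of the Cantor set. -/
noncomputable def code (a : ℕ → Bool) : ℝ := Real.ofDigits (fun i ↦ cond (a i) (2 : Fin 3) 0)

lemma code_nonneg (a : ℕ → Bool) : 0 ≤ code a := Real.ofDigits_nonneg _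
lemma code_le_one (a : ℕ → Bool) : code a ≤ 1 := Real.ofDigits_le_one _

lemma code_inj : Function.Injective code := by
  intro a b h
  have := ofDigits_zero_two_sequence_unique (by grind) (by grind) h
  funext i
  have := congrFun this i
  revert this
  cases a i <;> cases b i <;> simp

lemma code_lt_one {a : ℕ → Bool} (h : ∃ m, a m = false) : code a < 1 := by
  refine lt_of_le_of_ne (code_le_one a) fun h1 => ?_
  have h2 : code (fun _ => true) = 1 := by
    have := Real.ofDigits_const_last_eq_one 2
    unfold code
    convert! this
  obtain ⟨m, hm⟩ := h
  have := congrFun (code_inj (h1.trans h2.symm)) m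
  simp [hm] at this

lemma code_step (a : ℕ → Bool) :
    3 * code a = (cond (a 0) 2 0 : ℤ) + code (fun i => a (i + 1)) := by
  unfold code
  rw [Real.ofDigits_eq_sum_add_ofDigits _ 1]
  simp only [Finset.range_one, Finset.sum_singleton, Real.ofDigitsTerm]
  cases a 0 <;> simp <;> ring

lemma iterate_code {a : ℕ → Bool} (ha : ∀ n, ∃ m, a (m + n) = false) (n : ℕ) :
    (fun y : ℝ => Int.fract (3 * y))^[n] (code a) = code (fun i => a (i + n)) := by
  induction n with
  | zero => rfl
  | succ n ih =>
    rw [Function.iterate_succ_apply', ih]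
    rw [code_step, Int.fract_intCast_add, Int.fract_eq_self.2 ⟨code_nonneg _, code_lt_one _⟩]
    · congr 1; funext i; congr 1; ring
    · obtain ⟨m, hm⟩ := ha (n + 1)
      exact ⟨m, by rw [← hm]; congr 1; ring⟩

lemma code_sub_ge {a b : ℕ → Bool} {p : ℕ} (h : ∀ i < p, a i = b i) (hp : a p ≠ b p) :
    ((3 : ℝ) ^ (p + 1))⁻¹ ≤ |code a - code b| := by
  have key : code a - code b
      = ((3 : ℝ) ^ p)⁻¹ * (code (fun i => a (i + p)) - code (fun i => b (i + p))) := by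
    unfold code
    rw [Real.ofDigits_eq_sum_add_ofDigits (fun i ↦ cond (a i) (2 : Fin 3) 0) p,
      Real.ofDigits_eq_sum_add_ofDigits (fun i ↦ cond (b i) (2 : Fin 3) 0) p]
    have : ∑ i ∈ Finset.range p, Real.ofDigitsTerm (fun i ↦ cond (a i) (2 : Fin 3) 0) i =
        ∑ i ∈ Finset.range p, Real.ofDigitsTerm (fun i ↦ cond (b i) (2 : Fin 3) 0) i :=
      Finset.sum_congr rfl fun i hi ↦ by
        simp [Real.ofDigitsTerm, h i (Finset.mem_range.mp hi)]
    rw [this]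
    push_cast
    ring
  rw [key, abs_mul, abs_of_nonneg (by positivity), pow_succ, mul_inv]
  gcongr
  have h1 := code_step (fun i => a (i + p))
  have h2 := code_step (fun i => b (i + p))
  have a0 := code_nonneg (fun i => a (i + 1 + p))
  have a1 := code_le_one (fun i => a (i + 1 + p))
  have b0 := code_nonneg (fun i => b (i + 1 + p))
  have b1 := code_le_one (fun i => b (i + 1 + p))
  simp only [zero_add] at h1 h2
  rw [le_abs]
  cases hap : a p <;> cases hbp : b p <;> simp [hap, hbp] at hp h1 h2 <;>
    [right; left] <;> linarith

/-- The set of the main theorem. -/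
def recSet (t : ℝ) : Set ℝ := {x : ℝ | x ∈ cantorSet ∧
        ∃ᶠ n : ℕ in atTop,
          |(fun y : ℝ => Int.fract (3 * y))^[n] x - x| < (3 : ℝ) ^ (-(t * (n : ℝ)))}

lemma seq_mem {t : ℝ} (ht : 0 < t) {M : ℕ} (hM : 3 + t ≤ M) (b : ℕ → Bool) :
    code (seq t M b) ∈ recSet t := by
  have hM2 := two_le ht hM
  refine ⟨ofDigits_bool_to_fin_three_mem_cantorSet _, ?_⟩
  have hz : ∀ n, ∃ m, seq t M b (m + n) = false := by
    intro n
    have h1 : n ≤ M ^ (n + 1) :=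
      ((Nat.lt_succ_self n).trans (Nat.lt_pow_self (by omega))).le
    refine ⟨M ^ (n + 1) - n, ?_⟩
    rw [Nat.sub_add_cancel h1]
    have := seq_copy ht hM b n 0 (by omega)
    rwa [zero_add, seq_zero] at this
  rw [frequently_atTop]
  intro n
  refine ⟨M ^ (n + 1), ((Nat.lt_succ_self n).trans (Nat.lt_pow_self (by omega))).le, ?_⟩
  rw [iterate_code hz]
  have := Real.abs_ofDigits_sub_ofDigits_le
    (x := fun i ↦ cond (seq t M b (i + M ^ (n + 1))) (2 : Fin 3) 0)
    (y := fun i ↦ cond (seq t M b i) (2 : Fin 3) 0)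
    (n := ⌈t * (M : ℝ) ^ (n + 1)⌉₊ + 1) (fun i hi => by rw [seq_copy ht hM b n i hi])
  refine lt_of_le_of_lt this ?_
  rw [← Real.rpow_natCast, ← Real.rpow_neg (by positivity)]
  push_cast
  apply Real.rpow_lt_rpow_of_exponent_lt (by norm_num)
  have := Nat.le_ceil (t * (M : ℝ) ^ (n + 1))
  linarith

/-- The value in `[0,1]` of the free digits. -/
noncomputable def val (t : ℝ) (M : ℕ) (a : ℕ → Bool) : ℝ :=
  Real.ofDigits (fun k => cond (a (Nat.nth (Free t M) k)) (1 : Fin 2) 0)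

open Classical in
lemma holder {t : ℝ} (ht : 0 < t) {M : ℕ} (hM : 3 + t ≤ M) {κ : NNReal} (hκ : 0 < κ)
    (h : (1 + t) * (κ + 1 / M) ≤ 1) (r : NNReal) (hr : (r : ℝ) = Real.log 2 / Real.log 3 * κ) :
    HolderOnWith 64 r (fun x => val t M (Function.invFun code x))
      (code '' Set.univ) := by
  rintro _ ⟨a, -, rfl⟩ _ ⟨b, -, rfl⟩
  simp only [Function.leftInverse_invFun code_inj a, Function.leftInverse_invFun code_inj b]
  by_cases hab : a = b
  · subst hab; simp
  have hne : ∃ p, a p ≠ b p := Function.ne_iff.1 hab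
  let p := Nat.find hne
  have hp : a p ≠ b p := Nat.find_spec hne
  have hlt : ∀ i < p, a i = b i := fun i hi => by simpa using Nat.find_min hne hi
  have h1 := code_sub_ge hlt hp
  have h2 : |val t M a - val t M b| ≤ ((2 : ℝ) ^ Nat.count (Free t M) p)⁻¹ := by
    have := Real.abs_ofDigits_sub_ofDigits_le
      (x := fun k => cond (a (Nat.nth (Free t M) k)) (1 : Fin 2) 0)
      (y := fun k => cond (b (Nat.nth (Free t M) k)) (1 : Fin 2) 0)
      (n := Nat.count (Free t M) p) (fun i hi => by
        rw [hlt _ (Nat.nth_lt_of_lt_count hi)])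
    exact_mod_cast this
  have hc := count_free ht hM (κ := κ) (by exact_mod_cast hκ) h p
  have hκ1 : (κ : ℝ) ≤ 1 := by
    have h1 : 0 ≤ 1 / (M : ℝ) := by positivity
    have h2 : (0 : ℝ) ≤ κ := κ.2
    nlinarith
  have hmain : |val t M a - val t M b| ≤ 64 * |code a - code b| ^ (r : ℝ) := by
    have hl3 : 0 < Real.log 3 := Real.log_pos (by norm_num)
    have h3 : (2 : ℝ) ^ (-(κ * (p + 1)) : ℝ) ≤ |code a - code b| ^ (r : ℝ) := by
      have := Real.rpow_le_rpow (by positivity) h1 r.2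
      refine le_trans (le_of_eq ?_) this
      rw [show (r.1 : ℝ) = r from rfl, hr, ← Real.rpow_natCast, ← Real.rpow_neg (by norm_num),
        ← Real.rpow_mul (by norm_num), Real.rpow_def_of_pos (by norm_num),
        Real.rpow_def_of_pos (by norm_num)]
      congr 1
      push_cast
      field_simp
    calc _ ≤ _ := h2
      _ = (2 : ℝ) ^ (-(Nat.count (Free t M) p : ℝ)) := by
        rw [Real.rpow_neg (by norm_num), Real.rpow_natCast]
      _ ≤ (2 : ℝ) ^ ((6 : ℝ) + (-(κ * (p + 1)) : ℝ)) := by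
        apply Real.rpow_le_rpow_of_exponent_le (by norm_num)
        linarith
      _ = 64 * (2 : ℝ) ^ (-(κ * (p + 1)) : ℝ) := by
        rw [Real.rpow_add (by norm_num)]
        norm_num
      _ ≤ _ := by gcongr
  rw [edist_dist, edist_dist, Real.dist_eq, Real.dist_eq,
    ENNReal.ofReal_rpow_of_nonneg (abs_nonneg _) r.coe_nonneg]
  refine (ENNReal.ofReal_le_ofReal hmain).trans (le_of_eq ?_)
  rw [ENNReal.ofReal_mul (by norm_num)]
  norm_num

open Classical in
lemma lower_aux {t : ℝ} (ht : 0 < t) {M : ℕ} (hM : 3 + t ≤ M) {κ : NNReal} (hκ : 0 < κ)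
    (h : (1 + t) * (κ + 1 / M) ≤ 1) (r : NNReal) (hr : (r : ℝ) = Real.log 2 / Real.log 3 * κ) :
    (r : ENNReal) ≤ dimH (recSet t) := by
  have hr0 : 0 < r := by
    have h2 : 0 < Real.log 2 := Real.log_pos (by norm_num)
    have h3 : 0 < Real.log 3 := Real.log_pos (by norm_num)
    have : (0 : ℝ) < κ := by exact_mod_cast hκ
    have : (0 : ℝ) < r := by rw [hr]; positivity
    exact_mod_cast this
  let S : Set ℝ := Set.range (fun b => code (seq t M b))
  have hS : S ⊆ recSet t := by
    rintro _ ⟨b, rfl⟩; exact seq_mem ht hM b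
  have hH := (holder ht hM hκ h r hr).mono (t := S)
    (by rintro _ ⟨b, rfl⟩; exact ⟨_, trivial, rfl⟩)
  have hinf := free_infinite ht hM (κ := κ) (by exact_mod_cast hκ) h
  have himg : Set.Icc (0 : ℝ) 1 ⊆ (fun x => val t M (Function.invFun code x)) '' S := by
    intro y hy
    obtain ⟨d, -, hd⟩ := Real.ofDigits_SurjOn (b := 2) (by norm_num) hy
    refine ⟨_, ⟨fun k => decide (d k = 1), rfl⟩, ?_⟩
    simp only [Function.leftInverse_invFun code_inj _]
    rw [← hd]
    unfold val
    congr 1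
    funext k
    rw [seq_free ht hM _ _ (Nat.nth_mem_of_infinite hinf k), Nat.count_nth_of_infinite hinf]
    generalize d k = z
    fin_cases z <;> simp
  have h1 : dimH (Set.Icc (0 : ℝ) 1) = 1 := by
    have := Real.dimH_of_nonempty_interior (E := ℝ) (s := Set.Icc 0 1) (by simp)
    simpa using this
  have h2 := (dimH_mono himg).trans (hH.dimH_image_le hr0)
  rw [h1, ENNReal.le_div_iff_mul_le (by simp [hr0.ne']) (by simp), one_mul] at h2
  exact h2.trans (dimH_mono hS)

lemma lower {t : ℝ} (ht : 0 < t) :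
    ENNReal.ofReal ((Real.log 2 / Real.log 3) / (t + 1)) ≤ dimH (recSet t) := by
  have h2 : 0 < Real.log 2 := Real.log_pos (by norm_num)
  have h3 : 0 < Real.log 3 := Real.log_pos (by norm_num)
  refine le_of_forall_lt fun c hc => ?_
  obtain ⟨r, hcr, hr⟩ := ENNReal.lt_iff_exists_nnreal_btwn.1 hc
  refine hcr.trans_le ?_
  have hr' : (r : ℝ) < (Real.log 2 / Real.log 3) / (t + 1) := by
    rwa [← ENNReal.ofReal_coe_nnreal, ENNReal.ofReal_lt_ofReal_iff (by positivity)] at hr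
  have hr0 : 0 < r := by
    rcases eq_or_ne r 0 with h | h
    · subst h; simp at hcr
    · exact pos_iff_ne_zero.2 h
  have hr0' : (0 : ℝ) < r := by exact_mod_cast hr0
  let κ : NNReal := ⟨r * (Real.log 3 / Real.log 2), by positivity⟩
  have hκv : (κ : ℝ) = r * (Real.log 3 / Real.log 2) := rfl
  have hκ : (κ : ℝ) < 1 / (t + 1) := by
    rw [hκv]
    rw [lt_div_iff₀ (by positivity)] at hr' ⊢
    have : (r * (Real.log 3 / Real.log 2)) * (t + 1) =
      (r * (t + 1)) * (Real.log 3 / Real.log 2) := by ring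
    rw [this]
    calc _ < (Real.log 2 / Real.log 3) * (Real.log 3 / Real.log 2) := by gcongr
      _ = 1 := by field_simp
  obtain ⟨M, hM⟩ := exists_nat_ge (max (3 + t) (1 / (1 / (t + 1) - κ)))
  have hd : 0 < 1 / (t + 1) - (κ : ℝ) := by linarith
  have hM1 := (le_max_left _ _).trans hM
  have hM2 := (le_max_right _ _).trans hM
  have hM0 : (0 : ℝ) < M := by linarith
  refine lower_aux ht hM1 (κ := κ) ?_ ?_ r ?_
  · have : (0 : ℝ) < κ := by rw [hκv]; positivity
    exact_mod_cast this
  · rw [div_le_iff₀ hd] at hM2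
    have : 1 / (M : ℝ) ≤ 1 / (t + 1) - κ := by
      rw [div_le_iff₀ hM0]; linarith
    calc (1 + t) * ((κ : ℝ) + 1 / M) ≤ (1 + t) * (1 / (t + 1)) := by
          gcongr; linarith
      _ = 1 := by field_simp; ring
  · rw [hκv]; field_simp

/-- Integer parts of `3 ^ n * x`, for `x` in the Cantor set. -/
def parts : ℕ → Finset ℤ
  | 0 => {0, 1}
  | n + 1 => parts n ∪ (parts n).image (fun k => k + 2 * 3 ^ n)

lemma card_parts (n : ℕ) : (parts n).card ≤ 2 ^ (n + 1) := by
  induction n with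
  | zero => simp [parts]
  | succ n ih =>
    have h1 := Finset.card_union_le (parts n) ((parts n).image (fun k => k + 2 * 3 ^ n))
    have h2 := Finset.card_image_le (s := parts n) (f := fun k : ℤ => k + 2 * 3 ^ n)
    rw [parts, pow_succ]
    omega

lemma floor_mem_parts (n : ℕ) : ∀ x ∈ cantorSet, ⌊(3 : ℝ) ^ n * x⌋ ∈ parts n := by
  induction n with
  | zero =>
    intro x hx
    obtain ⟨h0, h1⟩ := cantorSet_subset_unitInterval hx
    have h2 : 0 ≤ ⌊x⌋ := Int.floor_nonneg.2 h0
    have h3 : ⌊x⌋ ≤ 1 := by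
      have := (Int.floor_le x).trans h1
      exact_mod_cast this
    simp only [parts, pow_zero, one_mul, Finset.mem_insert, Finset.mem_singleton]
    omega
  | succ n ih =>
    intro x hx
    rw [cantorSet_eq_union_halves] at hx
    simp only [parts, Finset.mem_union, Finset.mem_image]
    rcases hx with ⟨y, hy, rfl⟩ | ⟨y, hy, rfl⟩
    · left
      convert ih y hy using 2
      simp only [pow_succ]; ring
    · right
      refine ⟨_, ih y hy, ?_⟩
      rw [← Int.floor_add_intCast]
      congr 1
      push_cast
      simp only [pow_succ]; ring

lemma iterate_eq_fract (n : ℕ) (x : ℝ) :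
    (fun y : ℝ => Int.fract (3 * y))^[n + 1] x = Int.fract (3 ^ (n + 1) * x) := by
  induction n with
  | zero => simp
  | succ n ih =>
    rw [Function.iterate_succ_apply', ih]
    have : 3 * Int.fract ((3 : ℝ) ^ (n + 1) * x)
        = 3 ^ (n + 1 + 1) * x - ((3 * ⌊(3 : ℝ) ^ (n + 1) * x⌋ : ℤ) : ℝ) := by
      rw [Int.fract]; push_cast; rw [pow_succ _ (n + 1)]; ring
    rw [this, Int.fract_sub_intCast]

/-- Radius of the covering intervals. -/
noncomputable def rad (t : ℝ) (n : ℕ) : ℝ := 2 * ((3 : ℝ) ^ (-(1 + t))) ^ n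

lemma mem_ball {t x : ℝ} {n : ℕ} (hn : 1 ≤ n)
    (h : |(fun y : ℝ => Int.fract (3 * y))^[n] x - x| < (3 : ℝ) ^ (-(t * (n : ℝ)))) :
    x ∈ Metric.closedBall ((⌊(3 : ℝ) ^ n * x⌋ : ℝ) / (3 ^ n - 1)) (rad t n) := by
  obtain ⟨m, rfl⟩ := Nat.exists_eq_succ_of_ne_zero (by omega : n ≠ 0)
  simp only [Nat.succ_eq_add_one] at *
  rw [iterate_eq_fract, Int.fract] at h
  have h3 : (3 : ℝ) ≤ 3 ^ (m + 1) := by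
    rw [pow_succ]
    have : (1 : ℝ) ≤ 3 ^ m := one_le_pow₀ (by norm_num)
    linarith
  rw [Metric.mem_closedBall, Real.dist_eq]
  set k : ℝ := (⌊(3 : ℝ) ^ (m + 1) * x⌋ : ℝ)
  have hpos : (0 : ℝ) < 3 ^ (m + 1) - 1 := by linarith
  have e1 : x - k / (3 ^ (m + 1) - 1) = (3 ^ (m + 1) * x - k - x) / (3 ^ (m + 1) - 1) := by
    field_simp; ring
  rw [e1, abs_div, abs_of_pos hpos, div_le_iff₀ hpos]
  refine h.le.trans ?_
  have e2 : rad t (m + 1) = 2 * ((3 : ℝ) ^ (m + 1))⁻¹ * (3 : ℝ) ^ (-(t * ((m + 1 : ℕ) : ℝ))) := by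
    unfold rad
    rw [← Real.rpow_natCast, ← Real.rpow_natCast, ← Real.rpow_mul (by norm_num),
      ← Real.rpow_neg (by norm_num), mul_assoc, ← Real.rpow_add (by norm_num)]
    congr 2
    ring
  rw [e2]
  have hq : 0 < (3 : ℝ) ^ (-(t * ((m + 1 : ℕ) : ℝ))) := by positivity
  have : 1 ≤ 2 * ((3 : ℝ) ^ (m + 1))⁻¹ * (3 ^ (m + 1) - 1) := by
    rw [mul_assoc, mul_sub, inv_mul_cancel₀ (by positivity)]
    have : ((3 : ℝ) ^ (m + 1))⁻¹ ≤ 3⁻¹ := by gcongr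
    linarith
  nlinarith

lemma measure_zero {t : ℝ} (ht : 0 < t) {d : ℝ} (hd : 0 < d)
    (h : 2 * ((3 : ℝ) ^ (-(1 + t))) ^ d < 1) :
    MeasureTheory.Measure.hausdorffMeasure d (recSet t) = 0 := by
  set ρ : ℝ := (3 : ℝ) ^ (-(1 + t)) with hρ
  have hρ0 : 0 < ρ := by positivity
  have hρ1 : ρ < 1 := Real.rpow_lt_one_of_one_lt_of_neg (by norm_num) (by linarith)
  let ι : ℕ → Type := fun N => Σ m : ℕ, parts (m + (N + 1))
  let U : ∀ N, ι N → Set ℝ := fun N i =>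
    Metric.closedBall ((i.2.1 : ℝ) / (3 ^ (i.1 + (N + 1)) - 1)) (rad t (i.1 + (N + 1)))
  have hdiam : ∀ N (i : ι N), Metric.ediam (U N i) ≤ ENNReal.ofReal (4 * ρ ^ (i.1 + (N + 1))) := by
    intro N i
    refine Metric.ediam_le_of_forall_dist_le fun x hx y hy => ?_
    have := dist_triangle_right x y ((i.2.1 : ℝ) / (3 ^ (i.1 + (N + 1)) - 1))
    have hx' := Metric.mem_closedBall.1 hx
    have hy' := Metric.mem_closedBall.1 hy
    unfold rad at hx' hy'
    linarith
  have hr : Tendsto (fun N : ℕ => ENNReal.ofReal (4 * ρ ^ N)) atTop (nhds 0) := by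
    have h1 : Tendsto (fun N : ℕ => 4 * ρ ^ N) atTop (nhds (4 * 0)) :=
      (tendsto_pow_atTop_nhds_zero_of_lt_one hρ0.le hρ1).const_mul 4
    simpa using ENNReal.tendsto_ofReal h1
  have key := MeasureTheory.Measure.hausdorffMeasure_le_liminf_tsum d (recSet t) (l := atTop)
    (fun N : ℕ => ENNReal.ofReal (4 * ρ ^ N)) hr U
    (Eventually.of_forall fun N i => (hdiam N i).trans (ENNReal.ofReal_le_ofReal (by
      have := pow_le_pow_of_le_one hρ0.le hρ1.le (by omega : N ≤ i.1 + (N + 1))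
      linarith)))
    (Eventually.of_forall fun N x hx => by
      obtain ⟨n, hn, hxn⟩ := frequently_atTop.1 hx.2 (N + 1)
      obtain ⟨m, rfl⟩ : ∃ m, n = m + (N + 1) := ⟨n - (N + 1), by omega⟩
      exact Set.mem_iUnion.2 ⟨⟨m, ⟨_, floor_mem_parts _ x hx.1⟩⟩, mem_ball (by omega) hxn⟩)
  let f : ℕ → ENNReal := fun n => ENNReal.ofReal (2 * 4 ^ d * (2 * ρ ^ d) ^ n)
  have hfsum : ∑' n, f n ≠ ⊤ := by
    have : Summable (fun n : ℕ => 2 * 4 ^ d * (2 * ρ ^ d) ^ n) :=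
      (summable_geometric_of_lt_one (by positivity) h).mul_left _
    exact this.tsum_ofReal_ne_top
  have hf : ∀ N, ∑' i, Metric.ediam (U N i) ^ d ≤ ∑' m, f (m + (N + 1)) := by
    intro N
    refine (ENNReal.tsum_sigma' (fun i : ι N => Metric.ediam (U N i) ^ d)).le.trans ?_
    refine ENNReal.tsum_le_tsum fun m => ?_
    have hb : ∀ k : parts (m + (N + 1)), Metric.ediam (U N ⟨m, k⟩) ^ d
        ≤ ENNReal.ofReal (4 ^ d * (ρ ^ d) ^ (m + (N + 1))) := by
      intro k
      refine (ENNReal.rpow_le_rpow (hdiam N ⟨m, k⟩) hd.le).trans (le_of_eq ?_)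
      rw [ENNReal.ofReal_rpow_of_nonneg (by positivity) hd.le,
        Real.mul_rpow (by positivity) (by positivity), ← Real.rpow_natCast, ← Real.rpow_natCast,
        ← Real.rpow_mul hρ0.le, ← Real.rpow_mul hρ0.le, mul_comm d]
    refine (ENNReal.tsum_le_tsum hb).trans ?_
    rw [tsum_fintype, Finset.sum_const, nsmul_eq_mul, Finset.card_univ, Fintype.card_coe]
    have hc : ((parts (m + (N + 1))).card : ENNReal)
        ≤ ENNReal.ofReal ((2 : ℝ) ^ (m + (N + 1) + 1)) := by
      rw [ENNReal.ofReal_pow (by norm_num)]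
      have := card_parts (m + (N + 1))
      simp only [ENNReal.ofReal_ofNat]
      exact_mod_cast this
    refine (mul_le_mul_left hc _).trans ?_
    rw [← ENNReal.ofReal_mul (by positivity)]
    apply ENNReal.ofReal_le_ofReal
    apply le_of_eq
    rw [mul_pow, pow_succ]
    ring
  have htend : Tendsto (fun N => ∑' m, f (m + (N + 1))) atTop (nhds 0) :=
    (tendsto_add_atTop_iff_nat 1).2 (ENNReal.tendsto_sum_nat_add f hfsum)
  have : liminf (fun N => ∑' i, Metric.ediam (U N i) ^ d) atTop = 0 :=
    (tendsto_of_tendsto_of_tendsto_of_le_of_le tendsto_const_nhds htend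
      (fun _ => zero_le) hf).liminf_eq
  rw [this] at key
  exact le_antisymm key (zero_le)

lemma upper {t : ℝ} (ht : 0 < t) :
    dimH (recSet t) ≤ ENNReal.ofReal ((Real.log 2 / Real.log 3) / (t + 1)) := by
  have h2 : 0 < Real.log 2 := Real.log_pos (by norm_num)
  have h3 : 0 < Real.log 3 := Real.log_pos (by norm_num)
  refine le_of_forall_gt fun c hc => ?_
  obtain ⟨r, hr, hcr⟩ := ENNReal.lt_iff_exists_nnreal_btwn.1 hc
  refine lt_of_le_of_lt ?_ hcr
  have hr' : (Real.log 2 / Real.log 3) / (t + 1) < (r : ℝ) := by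
    rw [← ENNReal.ofReal_coe_nnreal] at hr
    exact (ENNReal.ofReal_lt_ofReal_iff_of_nonneg (by positivity)).1 hr
  have hr0 : (0 : ℝ) < r := lt_trans (by positivity) hr'
  apply dimH_le_of_hausdorffMeasure_ne_top
  rw [measure_zero ht hr0]
  · simp
  · rw [div_lt_iff₀ (by positivity), div_lt_iff₀ h3] at hr'
    rw [← Real.rpow_mul (by norm_num)]
    nth_rewrite 1 [← Real.exp_log (by norm_num : (0 : ℝ) < 2)]
    rw [Real.rpow_def_of_pos (by norm_num), ← Real.exp_add, Real.exp_lt_one_iff]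
    nlinarith

end CantorRec

/-- For the middle-thirds Cantor set `C` and the map `T x = 3x mod 1`, for any
`t > 0`, the Hausdorff dimension of the set of `x ∈ C` with `|T^n x − x| < 3^{-tn}`
infinitely often is `(log 2 / log 3)/(t+1)`. -/
theorem cantor_recurrence_dimH (t : ℝ) (ht : 0 < t) :
    dimH {x : ℝ | x ∈ cantorSet ∧
        ∃ᶠ n : ℕ in atTop,
          |(fun y : ℝ => Int.fract (3 * y))^[n] x - x| < (3 : ℝ) ^ (-(t * (n : ℝ)))} =
      ENNReal.ofReal ((Real.log 2 / Real.log 3) / (t + 1)) := by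
  exact le_antisymm (CantorRec.upper ht) (CantorRec.lower ht)
end
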